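/- arXiv:1310.8605 — 6 statements merged into one kernel-verified Lean document; each statement's English description precedes it below -/
import Mathlib

section
/- Let Γ be a finite irreducible simple graph, A = A(Γ) the associated right-angled Artin group, and H a subgroup of A such that H is not cyclic and H is not contained in any proper parabolic subgroup of A (i.e. the parabolic closure of H is all of A). Then H has trivial center, and there exists h ∈ H with h ≠ 1 such that the set {x ∈ A : ∃ k m : ℤ, k ≠ 0 ∧ m ≠ 0 ∧ x * h^k * x⁻¹ = h^m} equals the cyclic subgroup Subgroup.zpowers h (as subsets of A), and Subgroup.zpowers h is contained in H. -/
/-- The set of defining relators of the right-angled Artin group on `Γ`. -/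
abbrev raagRels {V : Type*} (Γ : SimpleGraph V) : Set (FreeGroup V) :=
  {r | ∃ u v : V, Γ.Adj u v ∧
    r = FreeGroup.of u * FreeGroup.of v * (FreeGroup.of u)⁻¹ * (FreeGroup.of v)⁻¹}

/-- The right-angled Artin group associated to a simple graph `Γ`. -/
abbrev RAAG {V : Type*} (Γ : SimpleGraph V) := PresentedGroup (raagRels Γ)

/-- The image of the vertex `v` in the right-angled Artin group on `Γ`. -/
abbrev raagGen {V : Type*} (Γ : SimpleGraph V) (v : V) : RAAG Γ := PresentedGroup.of v

/-- The full subgroup `A_U` of the right-angled Artin group, generated by the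
vertices in `U`. -/
def fullSubgroup {V : Type*} (Γ : SimpleGraph V) (U : Set V) : Subgroup (RAAG Γ) :=
  Subgroup.closure (raagGen Γ '' U)

/-- A graph `Γ` is irreducible if its vertex set cannot be partitioned into two
nonempty subsets `A` and `Aᶜ` such that every vertex of `A` is adjacent to every
vertex of `Aᶜ`. -/
def GraphIrreducible {V : Type*} (Γ : SimpleGraph V) : Prop :=
  ¬ ∃ A : Set V, A.Nonempty ∧ Aᶜ.Nonempty ∧ ∀ a ∈ A, ∀ b ∈ Aᶜ, Γ.Adj a b

section

open scoped Pointwise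

section WallFamily

variable {G X : Type*} [Group G] [MulAction G X]

/-- Two sets are nested if one of the four quadrants they determine is empty. -/
def NestedSets (P Q : Set X) : Prop :=
  P ⊆ Q ∨ Q ⊆ P ∨ P ⊆ Qᶜ ∨ Qᶜ ⊆ P

/-- A `G`-invariant family of pairwise nested halfspaces of `X`, closed under complements, such that
any two points are separated by finitely many members: the halfspaces of a tree. -/
structure WallFamily (G : Type*) {X : Type*} [Group G] [MulAction G X] (F : Set (Set X)) :
    Prop where
  smul_mem : ∀ (g : G) {P}, P ∈ F → g • P ∈ F
  compl_mem : ∀ {P}, P ∈ F → Pᶜ ∈ F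
  nonempty : ∀ {P}, P ∈ F → P.Nonempty
  nested : ∀ {P Q}, P ∈ F → Q ∈ F → NestedSets P Q
  finite_sep : ∀ a b : X, {P ∈ F | a ∈ P ∧ b ∉ P}.Finite

theorem smul_set_ssubset_smul_set_iff (g : G) {P Q : Set X} : g • P ⊂ g • Q ↔ P ⊂ Q := by
  simp only [ssubset_iff_subset_not_subset, Set.smul_set_subset_smul_set_iff]

theorem pow_smul_subset {g : G} {P : Set X} (h : g • P ⊆ P) (n : ℕ) : g ^ n • P ⊆ P := by
  induction n with
  | zero => simp
  | succ n ih =>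
    rw [pow_succ, mul_smul]
    exact (Set.smul_set_mono h).trans ih

theorem pow_smul_subset_pow_smul {g : G} {P : Set X} (h : g • P ⊆ P) {m n : ℕ} (hmn : m ≤ n) :
    g ^ n • P ⊆ g ^ m • P := by
  obtain ⟨k, rfl⟩ := Nat.exists_eq_add_of_le hmn
  rw [pow_add, mul_smul]
  exact Set.smul_set_mono (pow_smul_subset h k)

theorem pow_smul_ssubset {g : G} {P : Set X} (h : g • P ⊂ P) {n : ℕ} (hn : n ≠ 0) :
    g ^ n • P ⊂ P := by
  refine (pow_smul_subset_pow_smul h.subset (Nat.one_le_iff_ne_zero.2 hn)).trans_ssubset ?_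
  simpa using h

theorem pow_smul_ssubset_pow_smul {g : G} {P : Set X} (h : g • P ⊂ P) {m n : ℕ} (hmn : m < n) :
    g ^ n • P ⊂ g ^ m • P := by
  obtain ⟨k, rfl⟩ := Nat.exists_eq_add_of_lt hmn
  rw [add_assoc, pow_add, mul_smul, smul_set_ssubset_smul_set_iff]
  exact pow_smul_ssubset h (by omega)

theorem inv_smul_compl_ssubset {g : G} {P : Set X} (h : g • P ⊂ P) : g⁻¹ • Pᶜ ⊂ Pᶜ := by
  rw [Set.smul_set_compl, ssubset_iff_subset_not_subset, Set.compl_subset_compl,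
    Set.compl_subset_compl, ← ssubset_iff_subset_not_subset, ← smul_set_ssubset_smul_set_iff g,
    smul_inv_smul]
  exact h

/-- The members of `F` which are translated properly into themselves by `g`. -/
def axis (F : Set (Set X)) (g : G) : Set (Set X) := {P ∈ F | g • P ⊂ P}

/-- The number of members `R` of `F` with `B ⊂ R ⊆ A`. -/
noncomputable def gap (F : Set (Set X)) (A B : Set X) : ℕ := {R ∈ F | B ⊂ R ∧ R ⊆ A}.ncard

/-- If `g` translates both `P` and `Q` properly and `g`-translates of `P` are nested with `Q`, then
some translate of `P` lies in `Q`. -/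
theorem exists_pow_smul_subset {g : G} {P Q : Set X} (hP : P.Nonempty) (hQ : Q.Nonempty)
    (hQ' : Qᶜ.Nonempty) (hgP : g • P ⊆ P) (hPout : ∀ z, ∃ n : ℕ, z ∉ g ^ n • P)
    (hQin : ∀ z, ∃ n : ℕ, z ∈ (g ^ n)⁻¹ • Q) (hN : ∀ n : ℕ, NestedSets (g ^ n • P) Q) :
    ∃ n : ℕ, g ^ n • P ⊆ Q := by
  obtain ⟨a, ha⟩ := hQ
  obtain ⟨b, hb⟩ := hQ'
  obtain ⟨n₁, h₁⟩ := hPout a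
  obtain ⟨n₂, h₂⟩ := hPout b
  set n := max n₁ n₂
  have han : a ∉ g ^ n • P := fun h => h₁ (pow_smul_subset_pow_smul hgP (le_max_left _ _) h)
  have hbn : b ∉ g ^ n • P := fun h => h₂ (pow_smul_subset_pow_smul hgP (le_max_right _ _) h)
  rcases hN n with h | h | h | h
  · exact ⟨n, h⟩
  · exact absurd (h ha) han
  · exfalso
    obtain ⟨z, hz⟩ : (g ^ n • P).Nonempty := hP.smul_set
    obtain ⟨i, hi⟩ := hQin z
    rw [Set.mem_smul_set_iff_inv_smul_mem, inv_inv] at hi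
    have : g ^ i • z ∈ g ^ (n + i) • P := by
      rw [add_comm, pow_add, mul_smul]
      exact Set.smul_mem_smul_set hz
    exact h (pow_smul_subset_pow_smul hgP (Nat.le_add_right _ _) this) hi
  · exact absurd (h hb) hbn

theorem axis_inv {F : Set (Set X)} (hF : ∀ {P}, P ∈ F → Pᶜ ∈ F) {g : G} {P : Set X}
    (h : P ∈ axis F g) : Pᶜ ∈ axis F g⁻¹ :=
  ⟨hF h.1, inv_smul_compl_ssubset h.2⟩

namespace WallFamily

variable {F : Set (Set X)} {g h x y : G} {A B C P Q R : Set X}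

theorem exists_notMem_pow_smul (W : WallFamily G F) (hP : P ∈ axis F g) (z : X) :
    ∃ n : ℕ, z ∉ g ^ n • P := by
  by_contra! hz
  obtain ⟨b, hb⟩ := W.nonempty (W.compl_mem hP.1)
  refine Set.infinite_of_injective_forall_mem (f := fun n : ℕ => g ^ n • P) ?_ ?_
    (W.finite_sep z b)
  · have : StrictAnti fun n : ℕ => g ^ n • P := fun m n hmn => pow_smul_ssubset_pow_smul hP.2 hmn
    exact this.injective
  · exact fun n => ⟨W.smul_mem _ hP.1, hz n, fun h => hb (pow_smul_subset hP.2.subset n h)⟩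

theorem exists_mem_inv_pow_smul (W : WallFamily G F) (hP : P ∈ axis F g) (z : X) :
    ∃ n : ℕ, z ∈ (g ^ n)⁻¹ • P := by
  obtain ⟨n, hn⟩ := W.exists_notMem_pow_smul (axis_inv W.compl_mem hP) z
  refine ⟨n, ?_⟩
  rwa [Set.smul_set_compl, Set.notMem_compl_iff, inv_pow] at hn

theorem exists_pow_smul_subset (W : WallFamily G F) (hP : P ∈ axis F g) (hQ : Q ∈ axis F g) :
    ∃ n : ℕ, g ^ n • P ⊆ Q :=
  _root_.exists_pow_smul_subset (W.nonempty hP.1) (W.nonempty hQ.1)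
    (W.nonempty (W.compl_mem hQ.1)) hP.2.subset (W.exists_notMem_pow_smul hP)
    (W.exists_mem_inv_pow_smul hQ) fun _ => W.nested (W.smul_mem _ hP.1) hQ.1

theorem inter_nonempty (W : WallFamily G F) (hP : P ∈ axis F g) (hQ : Q ∈ axis F g) :
    (P ∩ Q).Nonempty := by
  obtain ⟨n, hn⟩ := W.exists_pow_smul_subset hP hQ
  exact (W.nonempty hP.1).smul_set.mono (Set.subset_inter (pow_smul_subset hP.2.subset n) hn)

theorem subset_or_subset (W : WallFamily G F) (hP : P ∈ axis F g) (hQ : Q ∈ axis F g) :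
    P ⊆ Q ∨ Q ⊆ P := by
  rcases W.nested hP.1 hQ.1 with h | h | h | h
  · exact .inl h
  · exact .inr h
  · obtain ⟨z, hz⟩ := W.inter_nonempty hP hQ
    exact absurd hz.2 (h hz.1)
  · obtain ⟨z, hz⟩ := W.inter_nonempty (axis_inv W.compl_mem hP) (axis_inv W.compl_mem hQ)
    exact absurd (h hz.2) hz.1

theorem axis_pow (W : WallFamily G F) {n : ℕ} (hn : n ≠ 0) : axis F (g ^ n) = axis F g := by
  ext P
  refine ⟨fun h => ⟨h.1, ?_⟩, fun h => ⟨h.1, pow_smul_ssubset h.2 hn⟩⟩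
  have hg : g • P ∈ axis F (g ^ n) := by
    refine ⟨W.smul_mem _ h.1, ?_⟩
    rw [smul_smul, ← pow_succ, pow_succ', mul_smul, smul_set_ssubset_smul_set_iff]
    exact h.2
  have key : ¬ P ⊆ g • P := fun hP => by
    have h1 : g⁻¹ • P ⊆ P := by
      rw [Set.smul_set_subset_iff_subset_inv_smul_set, inv_inv]; exact hP
    have h2 := pow_smul_subset h1 n
    rw [inv_pow, Set.smul_set_subset_iff_subset_inv_smul_set, inv_inv] at h2
    exact h.2.not_subset h2
  exact ⟨(W.subset_or_subset hg h).resolve_right key, key⟩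

theorem smul_mem_axis_of_commute (W : WallFamily G F) (hP : P ∈ axis F g) (hx : Commute x g) :
    x • P ∈ axis F g := by
  refine ⟨W.smul_mem _ hP.1, ?_⟩
  rw [smul_smul, ← hx.eq, mul_smul, smul_set_ssubset_smul_set_iff]
  exact hP.2

/-- An element fixing a member of `F` does not translate another one properly. -/
theorem smul_ne_of_mem_axis (W : WallFamily G F) (hR : R ∈ axis F g) (hP : P ∈ F) : g • P ≠ P := by
  intro hg
  have hgn (n : ℕ) : g ^ n • P = P := by
    induction n with
    | zero => simp
    | succ n ih => rw [pow_succ, mul_smul, hg, ih]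
  have hgn' (n : ℕ) : (g ^ n)⁻¹ • P = P := by rw [inv_smul_eq_iff, hgn]
  obtain ⟨a, ha⟩ := W.nonempty hP
  obtain ⟨b, hb⟩ := W.nonempty (W.compl_mem hP)
  obtain ⟨i, hi⟩ := W.exists_notMem_pow_smul hR a
  obtain ⟨j, hj⟩ := W.exists_notMem_pow_smul hR b
  obtain ⟨k, hk⟩ := W.exists_mem_inv_pow_smul hR a
  obtain ⟨l, hl⟩ := W.exists_mem_inv_pow_smul hR b
  rw [Set.mem_smul_set_iff_inv_smul_mem] at hi hj hk hl
  have mem (y : G) (hy : y • P = P) (z : X) : y • z ∈ P ↔ z ∈ P := by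
    conv_lhs => rw [← hy]
    exact Set.smul_mem_smul_set_iff
  have hai := (mem _ (hgn' i) a).2 ha
  have hbj := mt (mem _ (hgn' j) b).1 hb
  rw [inv_inv] at hk hl
  have hak := (mem _ (hgn k) a).2 ha
  have hbl := mt (mem _ (hgn l) b).1 hb
  rcases W.nested hP hR.1 with h | h | h | h
  · exact hi (h hai)
  · exact hbl (h hl)
  · exact h hak hk
  · exact hbj (h hj)

theorem finite_gap (W : WallFamily G F) (hA : A ∈ F) (hB : B ∈ F) :
    {R ∈ F | B ⊂ R ∧ R ⊆ A}.Finite := by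
  obtain ⟨a, ha⟩ := W.nonempty hB
  obtain ⟨b, hb⟩ := W.nonempty (W.compl_mem hA)
  exact (W.finite_sep a b).subset fun R hR => ⟨hR.1, hR.2.1.subset ha, fun h => hb (hR.2.2 h)⟩

theorem subset_or_subset_of_between (W : WallFamily G F) (hA : A ∈ F) (hB : B ∈ F) (hP : P ∈ F)
    (hQ : Q ∈ F) (hBP : B ⊆ P) (hPA : P ⊆ A) (hBQ : B ⊆ Q) (hQA : Q ⊆ A) : P ⊆ Q ∨ Q ⊆ P := by
  obtain ⟨a, ha⟩ := W.nonempty hB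
  obtain ⟨b, hb⟩ := W.nonempty (W.compl_mem hA)
  rcases W.nested hP hQ with h | h | h | h
  · exact .inl h
  · exact .inr h
  · exact absurd (hBQ ha) (h (hBP ha))
  · exact absurd (hPA (h fun hq => hb (hQA hq))) hb

theorem gap_add (W : WallFamily G F) (hA : A ∈ F) (hB : B ∈ F) (hC : C ∈ F) (hCB : C ⊆ B)
    (hBA : B ⊆ A) : gap F A C = gap F A B + gap F B C := by
  unfold gap
  rw [← Set.ncard_union_eq _ (W.finite_gap hA hB) (W.finite_gap hB hC)]
  · congr 1
    ext R
    simp only [Set.mem_ofPred_eq, Set.mem_union]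
    constructor
    · rintro ⟨hR, hCR, hRA⟩
      rcases W.subset_or_subset_of_between hA hC hR hB hCR.subset hRA hCB hBA with h | h
      · exact .inr ⟨hR, hCR, h⟩
      · by_cases hRB : R ⊆ B
        · exact .inr ⟨hR, hCR, hRB⟩
        · exact .inl ⟨hR, ⟨h, hRB⟩, hRA⟩
    · rintro (⟨hR, h1, h2⟩ | ⟨hR, h1, h2⟩)
      · exact ⟨hR, hCB.trans_ssubset h1, h2⟩
      · exact ⟨hR, h1, h2.trans hBA⟩
  · rw [Set.disjoint_left]
    exact fun R h1 h2 => h1.2.1.not_subset h2.2.2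

theorem gap_smul (W : WallFamily G F) (x : G) (A B : Set X) :
    gap F (x • A) (x • B) = gap F A B := by
  unfold gap
  symm
  refine Set.ncard_congr (fun R _ => x • R) ?_ ?_ ?_
  · rintro R ⟨hR, h1, h2⟩
    exact ⟨W.smul_mem _ hR, (smul_set_ssubset_smul_set_iff x).2 h1, Set.smul_set_mono h2⟩
  · intro R S _ _ h
    exact MulAction.injective x h
  · rintro R ⟨hR, h1, h2⟩
    refine ⟨x⁻¹ • R, ⟨W.smul_mem _ hR, ?_, ?_⟩, smul_inv_smul _ _⟩
    · rwa [← smul_set_ssubset_smul_set_iff x, smul_inv_smul]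
    · rwa [← Set.smul_set_subset_smul_set_iff (a := x), smul_inv_smul]

theorem gap_pos (W : WallFamily G F) (hA : A ∈ F) (hB : B ∈ F) (hBA : B ⊂ A) : 0 < gap F A B :=
  (Set.ncard_pos (W.finite_gap hA hB)).2 ⟨A, hA, hBA, subset_rfl⟩

theorem gap_lt (W : WallFamily G F) (hA : A ∈ F) (hB : B ∈ F) (hC : C ∈ F) (hCB : C ⊂ B)
    (hBA : B ⊆ A) : gap F A B < gap F A C := by
  rw [W.gap_add hA hB hC hCB.subset hBA]
  have := W.gap_pos hB hC hCB
  omega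

theorem eq_of_gap_eq (W : WallFamily G F) (hA : A ∈ F) (hP : P ∈ F) (hQ : Q ∈ F) (hPA : P ⊆ A)
    (hQA : Q ⊆ A) (hPQ : P ⊆ Q ∨ Q ⊆ P) (h : gap F A P = gap F A Q) : P = Q := by
  rcases hPQ with h1 | h1
  · rcases h1.eq_or_ssubset with h2 | h2
    · exact h2
    · exact absurd h (W.gap_lt hA hQ hP h2 hQA).ne'
  · rcases h1.eq_or_ssubset with h2 | h2
    · exact h2.symm
    · exact absurd h (W.gap_lt hA hP hQ h2 hPA).ne

/-- The translation length of `g` can be read off at any point of its axis. -/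
theorem gap_smul_self_eq (W : WallFamily G F) (hP : P ∈ axis F g) (hQ : Q ∈ axis F g) :
    gap F P (g • P) = gap F Q (g • Q) := by
  wlog h : P ⊆ Q generalizing P Q
  · exact (this hQ hP ((W.subset_or_subset hP hQ).resolve_left h)).symm
  have hgP := W.smul_mem g hP.1
  have hgQ := W.smul_mem g hQ.1
  have h1 := W.gap_add hQ.1 hP.1 hgP hP.2.subset h
  have h2 := W.gap_add hQ.1 hgQ hgP (Set.smul_set_mono h) hQ.2.subset
  rw [W.gap_smul] at h2
  omega

theorem smul_smul_comm_of_mem_axis (W : WallFamily G F) (hR : R ∈ axis F g)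
    (hxR : x • R ∈ axis F g) (hxgR : x • g • R ∈ axis F g) : x • g • R = g • x • R := by
  have hgx : g • x • R ∈ axis F g := W.smul_mem_axis_of_commute hxR (Commute.refl g)
  refine W.eq_of_gap_eq hxR.1 hxgR.1 hgx.1 (Set.smul_set_mono hR.2.subset) hxR.2.subset
    (W.subset_or_subset hxgR hgx) ?_
  rw [W.gap_smul, W.gap_smul_self_eq hR hxR]

theorem commute_of_smul_smul_eq (hfix : ∀ y : G, (∀ R ∈ axis F g, y • R = R) → y = 1)
    (h : ∀ R ∈ axis F g, x • g • R = g • x • R) : Commute x g := by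
  have := hfix ((g * x)⁻¹ * (x * g)) fun R hR => by
    rw [mul_smul, inv_smul_eq_iff, mul_smul, mul_smul, h R hR]
  exact (inv_mul_eq_one.1 this).symm

/-- An element preserving the axis of `g` commutes with `g`. -/
theorem commute_of_forall_smul_mem_axis (W : WallFamily G F)
    (hfix : ∀ y : G, (∀ R ∈ axis F g, y • R = R) → y = 1)
    (h : ∀ R ∈ axis F g, x • R ∈ axis F g) : Commute x g :=
  commute_of_smul_smul_eq hfix fun R hR => W.smul_smul_comm_of_mem_axis hR (h R hR)
    (h _ (W.smul_mem_axis_of_commute hR (Commute.refl g)))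

theorem axis_subset_axis_of_commute (W : WallFamily G F) (hgh : Commute g h) (hg : R ∈ axis F g)
    (hh : R ∈ axis F h) : axis F g ⊆ axis F h := by
  intro P hP
  refine ⟨hP.1, ?_⟩
  have hhP := W.smul_mem_axis_of_commute hP hgh.symm
  have key : ¬ P ⊆ h • P := fun h1 => by
    have h2 : h⁻¹ • P ⊆ P := by
      rw [Set.smul_set_subset_iff_subset_inv_smul_set, inv_inv]; exact h1
    obtain ⟨i, hi⟩ := W.exists_pow_smul_subset hP hg
    obtain ⟨a, ha⟩ := W.nonempty (W.smul_mem (g ^ i) hP.1)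
    obtain ⟨n, hn⟩ := W.exists_notMem_pow_smul hh a
    apply hn
    rw [Set.mem_smul_set_iff_inv_smul_mem]
    apply hi
    have h3 := Set.smul_set_mono (a := g ^ i) (pow_smul_subset h2 n)
    rw [smul_smul, inv_pow, ((hgh.pow_pow i n).inv_right).eq, mul_smul] at h3
    exact h3 (Set.smul_mem_smul_set ha)
  exact ⟨(W.subset_or_subset hhP hP).resolve_right key, key⟩

theorem axis_eq_axis_of_commute (W : WallFamily G F) (hgh : Commute g h) (hg : R ∈ axis F g)
    (hh : R ∈ axis F h) : axis F g = axis F h :=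
  (W.axis_subset_axis_of_commute hgh hg hh).antisymm (W.axis_subset_axis_of_commute hgh.symm hh hg)
theorem zpow_smul_mem_axis (W : WallFamily G F) (hQ : Q ∈ axis F g) (i : ℤ) :
    g ^ i • Q ∈ axis F g :=
  W.smul_mem_axis_of_commute hQ ((Commute.refl g).zpow_left i)

theorem zpow_smul_ssubset (hQ : Q ∈ axis F g) {i j : ℤ} (hij : i < j) : g ^ j • Q ⊂ g ^ i • Q := by
  obtain ⟨n, rfl⟩ := Int.le.dest hij.le
  rw [zpow_add, mul_smul, smul_set_ssubset_smul_set_iff, zpow_natCast]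
  exact pow_smul_ssubset hQ.2 (by omega)

theorem zpow_smul_subset (hQ : Q ∈ axis F g) {i j : ℤ} (hij : i ≤ j) : g ^ j • Q ⊆ g ^ i • Q := by
  rcases hij.eq_or_lt with rfl | h
  · rfl
  · exact (zpow_smul_ssubset hQ h).subset

theorem mem_axis_of_between (W : WallFamily G F) (hQ : Q ∈ axis F g) (hP : P ∈ F) {n : ℕ}
    (hPQ : P ⊆ Q) (hQP : g ^ n • Q ⊆ P) : P ∈ axis F g := by
  rw [← W.axis_pow n.succ_ne_zero]
  exact ⟨hP, ((Set.smul_set_mono hPQ).trans_ssubset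
    (pow_smul_ssubset_pow_smul hQ.2 n.lt_succ_self)).trans_subset hQP⟩

theorem exists_zpow_smul_ssubset (W : WallFamily G F) (hQ : Q ∈ axis F g) (hP : P ∈ axis F g) :
    ∃ i : ℤ, g ^ (i + 1) • Q ⊂ P ∧ P ⊆ g ^ i • Q := by
  obtain ⟨n, hn⟩ := W.exists_pow_smul_subset hP hQ
  obtain ⟨m, hm⟩ := W.exists_pow_smul_subset hQ hP
  obtain ⟨i, hi, hmax⟩ := Int.exists_greatest_of_bdd (P := fun i : ℤ => P ⊆ g ^ i • Q)
    ⟨m, fun z hz => by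
      by_contra! hlt
      have := (zpow_smul_ssubset hQ hlt).trans_subset (by simpa using hm)
      exact this.not_subset hz⟩
    ⟨-n, by
      rw [Set.smul_set_subset_iff_subset_inv_smul_set] at hn
      simpa using hn⟩
  refine ⟨i, ?_, hi⟩
  have h1 : ¬ P ⊆ g ^ (i + 1) • Q := fun h => by
    have := hmax _ h
    omega
  exact ⟨(W.subset_or_subset hP (W.zpow_smul_mem_axis hQ _)).resolve_left h1, h1⟩

theorem smul_eq_or_mem_axis (hP : P ∈ F) (h : y • P ⊆ P ∨ P ⊆ y • P) :
    y • P = P ∨ P ∈ axis F y ∨ P ∈ axis F y⁻¹ := by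
  by_cases he : y • P = P
  · exact .inl he
  refine .inr (h.imp (fun h => ⟨hP, h.ssubset_of_ne he⟩) fun h => ⟨hP, ?_⟩)
  rw [← smul_set_ssubset_smul_set_iff y, smul_inv_smul]
  exact h.ssubset_of_ne (Ne.symm he)

theorem smul_eq_of_commute (W : WallFamily G F) (hP : P ∈ F) (hyP : y • P = P)
    (hyh : Commute y h) (hR : R ∈ axis F h) : y • R = R := by
  rcases smul_eq_or_mem_axis hR.1 (W.subset_or_subset (W.smul_mem_axis_of_commute hR hyh) hR)
    with h1 | h1 | h1
  · exact h1
  · exact absurd hyP (W.smul_ne_of_mem_axis h1 hP)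
  · exact absurd (inv_smul_eq_iff.2 hyP.symm) (W.smul_ne_of_mem_axis h1 hP)

theorem commute_of_commute (W : WallFamily G F) (hR : R ∈ axis F h)
    (hfix : ∀ y : G, (∀ R ∈ axis F h, y • R = R) → y = 1) (hyh : Commute y h) (hy : y ≠ 1)
    (hxy : Commute x y) : Commute x h := by
  refine W.commute_of_forall_smul_mem_axis hfix fun S hS => ?_
  rcases smul_eq_or_mem_axis hR.1 (W.subset_or_subset (W.smul_mem_axis_of_commute hR hyh) hR)
    with h1 | h1 | h1
  · exact absurd (hfix y fun T hT => W.smul_eq_of_commute hR.1 h1 hyh hT) hy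
  · rw [W.axis_eq_axis_of_commute hyh.symm hR h1] at hS ⊢
    exact W.smul_mem_axis_of_commute hS hxy
  · rw [W.axis_eq_axis_of_commute hyh.inv_left.symm hR h1] at hS ⊢
    exact W.smul_mem_axis_of_commute hS hxy.inv_right

theorem commute_of_conj_zpow (W : WallFamily G F) (htor : ∀ x : G, x ^ 2 = 1 → x = 1)
    (hR : R ∈ axis F h) (hfix : ∀ y : G, (∀ R ∈ axis F h, y • R = R) → y = 1) {k m : ℤ}
    (hk : k ≠ 0) (hm : m ≠ 0) (hx : x * h ^ k * x⁻¹ = h ^ m) : Commute x h := by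
  have hconj (i : ℤ) : x * h ^ (k * i) * x⁻¹ = h ^ (m * i) := by
    rw [zpow_mul, zpow_mul, ← hx, conj_zpow]
  have hcast (i : ℤ) : h ^ (i.natAbs * i.natAbs) = h ^ (i * i) := by
    rw [← zpow_natCast, Int.natCast_mul, Int.natAbs_mul_self']
  have hsq : x ^ 2 * h ^ (k.natAbs * k.natAbs) = h ^ (m.natAbs * m.natAbs) * x ^ 2 := by
    rw [hcast, hcast, ← hconj, mul_comm k m, ← hconj, pow_two]
    group
  have hk' : k.natAbs * k.natAbs ≠ 0 := by simpa using hk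
  have hm' : m.natAbs * m.natAbs ≠ 0 := by simpa using hm
  have h2 : Commute (x ^ 2) h := by
    refine W.commute_of_forall_smul_mem_axis hfix fun S hS => ?_
    rw [← W.axis_pow hm']
    rw [← W.axis_pow hk'] at hS
    refine ⟨W.smul_mem _ hS.1, ?_⟩
    rw [smul_smul, ← hsq, mul_smul, smul_set_ssubset_smul_set_iff]
    exact hS.2
  by_cases hx2 : x ^ 2 = 1
  · rw [htor x hx2]
    exact Commute.one_left h
  · exact W.commute_of_commute hR hfix h2 hx2 ((Commute.refl x).pow_right 2)

theorem exists_mem_zpow_smul (W : WallFamily G F) (hQ : Q ∈ axis F g) (z z' : X) :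
    ∃ i : ℤ, z ∈ g ^ i • Q ∧ z' ∈ g ^ i • Q := by
  obtain ⟨i, hi⟩ := W.exists_mem_inv_pow_smul hQ z
  obtain ⟨j, hj⟩ := W.exists_mem_inv_pow_smul hQ z'
  refine ⟨-(max i j : ℕ), zpow_smul_subset (j := -(i : ℤ)) hQ (by omega) (by simpa using hi),
    zpow_smul_subset (j := -(j : ℤ)) hQ (by omega) (by simpa using hj)⟩

theorem exists_notMem_zpow_smul (W : WallFamily G F) (hQ : Q ∈ axis F g) (z z' : X) :
    ∃ i : ℤ, z ∉ g ^ i • Q ∧ z' ∉ g ^ i • Q := by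
  obtain ⟨i, hi⟩ := W.exists_notMem_pow_smul hQ z
  obtain ⟨j, hj⟩ := W.exists_notMem_pow_smul hQ z'
  refine ⟨(max i j : ℕ), fun h => hi ?_, fun h => hj ?_⟩
  · simpa using zpow_smul_subset (i := i) hQ (by omega) h
  · simpa using zpow_smul_subset (i := j) hQ (by omega) h

end WallFamily

/-- `y` maps no translate of `Q` by a power of `g` into another one. -/
def Flips (g : G) (Q : Set X) (y : G) : Prop :=
  ∀ a c : ℤ, ¬ y • g ^ a • Q ⊆ g ^ c • Q

/-- `y` fixes the end of the axis of `g` towards which the powers of `g` move `Q`. -/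
def FixesEnd (g : G) (Q : Set X) (y : G) : Prop :=
  ∀ a : ℤ, ∃ c : ℤ, y • g ^ c • Q ⊆ g ^ a • Q

theorem FixesEnd.mul {g : G} {Q : Set X} {y z : G} (hy : FixesEnd g Q y) (hz : FixesEnd g Q z) :
    FixesEnd g Q (y * z) := by
  intro a
  obtain ⟨b, hb⟩ := hy a
  obtain ⟨c, hc⟩ := hz b
  exact ⟨c, by rw [mul_smul]; exact (Set.smul_set_mono hc).trans hb⟩

theorem FixesEnd.pow {g : G} {Q : Set X} {y : G} (hy : FixesEnd g Q y) (n : ℕ) :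
    FixesEnd g Q (y ^ n) := by
  induction n with
  | zero => exact fun a => ⟨a, by simp⟩
  | succ n ih => rw [pow_succ]; exact ih.mul hy

theorem FixesEnd.not_flips {g : G} {Q : Set X} {y : G} (hy : FixesEnd g Q y) : ¬ Flips g Q y :=
  fun h => let ⟨c, hc⟩ := hy 0; h c 0 hc

namespace WallFamily

variable {F : Set (Set X)} {g h x y z : G} {A B C P Q R : Set X}

theorem fixesEnd_of_flips (W : WallFamily G F) (hQ : Q ∈ axis F g) (hy : Flips g Q y)
    (hz : Flips g Q z) : FixesEnd g Q (y⁻¹ * z) := by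
  intro a
  have hQ' (i : ℤ) : g ^ i • Q ∈ F := W.smul_mem _ hQ.1
  obtain ⟨e, he⟩ := W.nonempty (W.smul_mem y (hQ' a))
  obtain ⟨b, hb⟩ := W.nonempty (W.compl_mem (W.smul_mem y (hQ' a)))
  obtain ⟨c, hce, hcb⟩ := W.exists_mem_zpow_smul hQ e b
  have h1 : (g ^ c • Q)ᶜ ⊆ y • g ^ a • Q := by
    rcases W.nested (W.smul_mem y (hQ' a)) (hQ' c) with h | h | h | h
    · exact absurd h (hy a c)
    · exact absurd (h hcb) hb
    · exact absurd hce (h he)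
    · exact h
  obtain ⟨e', he'⟩ := W.nonempty (hQ' c)
  obtain ⟨b', hb'⟩ := W.nonempty (W.compl_mem (hQ' c))
  obtain ⟨d, hde, hdb⟩ := W.exists_notMem_zpow_smul hQ (z⁻¹ • e') (z⁻¹ • b')
  rw [← Set.mem_smul_set_iff_inv_smul_mem] at hde hdb
  have h2 : z • g ^ d • Q ⊆ (g ^ c • Q)ᶜ := by
    rcases W.nested (W.smul_mem z (hQ' d)) (hQ' c) with h | h | h | h
    · exact absurd h (hz d c)
    · exact absurd (h he') hde
    · exact h
    · exact absurd (h hb') hdb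
  refine ⟨d, ?_⟩
  rw [mul_smul, Set.smul_set_subset_iff_subset_inv_smul_set, inv_inv]
  exact h2.trans h1

theorem exists_pow_not_flips (W : WallFamily G F) (hQ : Q ∈ axis F g) (x : G) :
    ∃ d : ℕ, d ≠ 0 ∧ ∀ k : ℕ, k ≠ 0 → ¬ Flips g Q (x ^ (d * k)) := by
  by_cases h : ∃ e d : ℕ, d ≠ 0 ∧ Flips g Q (x ^ e) ∧ Flips g Q (x ^ (e + d))
  · obtain ⟨e, d, hd, he, hed⟩ := h
    have hfix := W.fixesEnd_of_flips hQ he hed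
    rw [pow_add, inv_mul_cancel_left] at hfix
    exact ⟨d, hd, fun k _ => by rw [pow_mul]; exact (hfix.pow k).not_flips⟩
  · push Not at h
    by_cases h' : ∃ e : ℕ, Flips g Q (x ^ e)
    · obtain ⟨e, he⟩ := h'
      refine ⟨e + 1, by omega, fun k hk => ?_⟩
      obtain ⟨j, rfl⟩ := Nat.exists_eq_succ_of_ne_zero hk
      have := h e (1 + (e + 1) * j) (by omega) he
      convert this using 3
      rw [Nat.succ_eq_add_one]
      ring
    · push Not at h'
      exact ⟨1, one_ne_zero, fun k _ => h' _⟩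

theorem gap_pow_smul (W : WallFamily G F) (hQ : Q ∈ axis F g) (n : ℕ) :
    gap F Q (g ^ n • Q) = n * gap F Q (g • Q) := by
  induction n with
  | zero =>
    have := W.gap_add hQ.1 hQ.1 hQ.1 subset_rfl subset_rfl
    rw [pow_zero, one_smul]
    omega
  | succ n ih =>
    rw [W.gap_add hQ.1 (W.smul_mem _ hQ.1) (W.smul_mem _ hQ.1)
      (pow_smul_subset_pow_smul hQ.2.subset n.le_succ) (pow_smul_subset hQ.2.subset n), ih,
      pow_succ, mul_smul, W.gap_smul]
    ring

/-- A group commuting with `h` is generated by any of its elements with minimal translation length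
along the axis of `h`. -/
theorem le_zpowers_of_gap_minimal (W : WallFamily G F)
    (hfix : ∀ y : G, (∀ R ∈ axis F h, y • R = R) → y = 1) (hQh : Q ∈ axis F h) {K : Subgroup G}
    (hK : ∀ y ∈ K, Commute y h) {r : G} (hr : r ∈ K) (hQr : Q ∈ axis F r)
    (hmin : ∀ y ∈ K, Q ∈ axis F y → gap F Q (r • Q) ≤ gap F Q (y • Q)) :
    K ≤ Subgroup.zpowers r := by
  intro y hy
  have hax : axis F r = axis F h := W.axis_eq_axis_of_commute (hK r hr) hQr hQh
  have hyQ : y • Q ∈ axis F r := by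
    rw [hax]
    exact W.smul_mem_axis_of_commute hQh (hK y hy)
  obtain ⟨i, h1, h2⟩ := W.exists_zpow_smul_ssubset hQr hyQ
  have hz : r ^ (-i) * y ∈ K := K.mul_mem (K.zpow_mem hr _) hy
  have hz1 : r • Q ⊂ (r ^ (-i) * y) • Q := by
    rw [← smul_set_ssubset_smul_set_iff (r ^ i), smul_smul, ← mul_smul]
    simpa [← zpow_add_one] using h1
  have hz2 : (r ^ (-i) * y) • Q ⊆ Q := by
    rw [← Set.smul_set_subset_smul_set_iff (a := r ^ i), ← mul_smul]
    simpa using h2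
  rcases hz2.eq_or_ssubset with h3 | h3
  · have := hfix _ fun R hR => W.smul_eq_of_commute hQh.1 h3 (hK _ hz) hR
    rw [zpow_neg, inv_mul_eq_one] at this
    exact ⟨i, this⟩
  · exact absurd (hmin _ hz ⟨hQh.1, h3⟩)
      (W.gap_lt hQh.1 (W.smul_mem _ hQh.1) (W.smul_mem _ hQh.1) hz1 hz2).not_ge

theorem exists_mem_not_commute (W : WallFamily G F)
    (hfix : ∀ y : G, (∀ R ∈ axis F g, y • R = R) → y = 1) (hQ : Q ∈ axis F g) {H : Subgroup G}
    (hg : g ∈ H) (hcyc : ¬ IsCyclic H) : ∃ x ∈ H, ¬ Commute x g := by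
  by_contra! hcomm
  obtain ⟨r, ⟨hrH, hQr⟩, hmin⟩ := exists_minimalFor_of_wellFoundedLT
    (fun y : G => y ∈ H ∧ Q ∈ axis F y) (fun y => gap F Q (y • Q)) ⟨g, hg, hQ⟩
  have hle := W.le_zpowers_of_gap_minimal hfix hQ hcomm hrH hQr
    fun y hy hQy => (le_total _ _).elim id (hmin ⟨hy, hQy⟩)
  exact hcyc ((Subgroup.isCyclic_iff_exists_zpowers_eq_top H).2
    ⟨r, hle.antisymm' (Subgroup.zpowers_le.2 hrH)⟩)

theorem exists_pow_mul_centralizer (W : WallFamily G F) (hQ : Q ∈ axis F g) {D : ℕ}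
    (hst : ∀ x : G, x • Q = Q → x • g ^ D • Q = g ^ D • Q → x = 1) (hxQ : x • Q ⊆ Q)
    (hxg : ¬ Commute x g) :
    ∃ N : ℕ, Q ∈ axis F (g ^ N * x) ∧
      (∀ y : G, (∀ R ∈ axis F (g ^ N * x), y • R = R) → y = 1) ∧
      ∀ y : G, Commute y (g ^ N * x) → y ∈ Subgroup.zpowers (g ^ N * x) := by
  have hgQ (n : ℕ) : g ^ n • Q ∈ axis F g :=
    W.smul_mem_axis_of_commute hQ ((Commute.refl g).pow_left n)
  have hfixg : ∀ y : G, (∀ R ∈ axis F g, y • R = R) → y = 1 :=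
    fun y hy => hst y (hy Q hQ) (hy _ (hgQ D))
  set t := gap F Q (g • Q) with ht
  set K := gap F Q (x • Q) with hK
  have ht0 : 0 < t := W.gap_pos hQ.1 (W.smul_mem g hQ.1) hQ.2
  set N := K + 2 * D + 3 with hN
  set h := g ^ N * x with hh
  have hhQ : h • Q ⊆ g ^ N • Q := by
    rw [hh, mul_smul]
    exact Set.smul_set_mono hxQ
  have hax (i : ℕ) (hi : i ≤ N) : g ^ i • Q ∈ axis F h := by
    refine ⟨(hgQ i).1, ?_⟩
    rcases hi.eq_or_lt with rfl | hi
    · rw [hh, ← smul_smul, smul_set_ssubset_smul_set_iff]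
      refine ssubset_of_ssubset_of_subset ?_ hxQ
      rw [smul_set_ssubset_smul_set_iff]
      exact pow_smul_ssubset hQ.2 (by omega)
    · exact ((Set.smul_set_mono (pow_smul_subset hQ.2.subset i)).trans hhQ).trans_ssubset
        (pow_smul_ssubset_pow_smul hQ.2 hi)
  have hQh : Q ∈ axis F h := by simpa using hax 0 (Nat.zero_le _)
  have hgap : gap F Q (h • Q) = N * t + K := by
    rw [W.gap_add hQ.1 (hgQ N).1 (W.smul_mem _ hQ.1) hhQ (pow_smul_subset hQ.2.subset N),
      W.gap_pow_smul hQ, hh, mul_smul, W.gap_smul]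
  have hfixh : ∀ y : G, (∀ R ∈ axis F h, y • R = R) → y = 1 :=
    fun y hy => hst y (hy Q hQh) (hy _ (hax D (by omega)))
  have no_root (r : G) (hrh : Commute r h) (hQr : Q ∈ axis F r) :
      N * t + K < 2 * gap F Q (r • Q) := by
    by_contra! hle
    have haxr : axis F r = axis F h := W.axis_eq_axis_of_commute hrh hQr hQh
    have hrg (i : ℕ) (hi : i ≤ D + 1) : r • g ^ i • Q ∈ axis F g := by
      have hi1 := hax i (by omega)
      have hi2 : g ^ i • Q ∈ axis F r := haxr ▸ hi1
      have hri := W.smul_mem_axis_of_commute hi1 hrh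
      have hsub : g ^ i • Q ⊆ Q := pow_smul_subset hQ.2.subset i
      have hg1 : gap F Q (r • g ^ i • Q) = i * t + gap F Q (r • Q) := by
        rw [W.gap_add hQ.1 hi1.1 hri.1 hi2.2.subset hsub, W.gap_pow_smul hQ,
          W.gap_smul_self_eq hi2 hQr]
      refine W.mem_axis_of_between hQ hri.1 (hi2.2.subset.trans hsub) (n := N) ?_
      refine (W.subset_or_subset (hax N le_rfl) hri).resolve_right fun hc => ?_
      have hg2 := W.gap_add hQ.1 (hgQ N).1 hri.1 hc (pow_smul_subset hQ.2.subset N)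
      rw [hg1, W.gap_pow_smul hQ, ← ht] at hg2
      have h1 : i * t ≤ (D + 1) * t := Nat.mul_le_mul_right t hi
      have h2 : N * t = K * t + 2 * ((D + 1) * t) + t := by rw [hN]; ring
      have h3 : K ≤ K * t := Nat.le_mul_of_pos_right K ht0
      omega
    have hc (i : ℕ) (hi : i ≤ D) : r • g • g ^ i • Q = g • r • g ^ i • Q := by
      refine W.smul_smul_comm_of_mem_axis (hgQ i) (hrg i (by omega)) ?_
      rw [smul_smul g, ← pow_succ']
      exact hrg (i + 1) (by omega)
    have hrg' : Commute r g := by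
      have := hst ((g * r)⁻¹ * (r * g))
        (by
          have := hc 0 (Nat.zero_le _)
          rw [pow_zero, one_smul] at this
          rw [mul_smul, inv_smul_eq_iff, mul_smul, mul_smul, this])
        (by rw [mul_smul, inv_smul_eq_iff, mul_smul, mul_smul, hc D le_rfl])
      exact (inv_mul_eq_one.1 this).symm
    have hr1 : r ≠ 1 := by
      rintro rfl
      simpa using hQr.2
    refine hxg (W.commute_of_commute hQ hfixg hrg' hr1 ?_)
    have : x = (g ^ N)⁻¹ * h := by simp [hh]
    rw [this]
    exact ((hrg'.symm.pow_left N).inv_left).mul_left hrh.symm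
  refine ⟨N, hQh, hfixh, fun y hy => ?_⟩
  refine W.le_zpowers_of_gap_minimal hfixh hQh (K := Subgroup.centralizer {h}) ?_ ?_ hQh ?_ ?_
  · exact fun z hz => (Subgroup.mem_centralizer_singleton_iff.1 hz)
  · exact Subgroup.mem_centralizer_singleton_iff.2 rfl
  · intro r hr hQr
    have hrh : Commute r h := Subgroup.mem_centralizer_singleton_iff.1 hr
    by_contra! hlt
    have hrQ := W.smul_mem_axis_of_commute hQh hrh
    have hhQ' := W.smul_mem_axis_of_commute hQh (Commute.refl h)
    have hsub : h • Q ⊂ r • Q := by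
      have hn : ¬ r • Q ⊆ h • Q := fun hc => by
        have := W.gap_add hQ.1 hhQ'.1 hrQ.1 hc hQh.2.subset
        omega
      exact ⟨(W.subset_or_subset hhQ' hrQ).resolve_right hn, hn⟩
    have hsQ : Q ∈ axis F (r⁻¹ * h) := by
      refine ⟨hQ.1, ?_⟩
      rw [← smul_set_ssubset_smul_set_iff r, mul_smul, smul_inv_smul]
      exact hsub
    have h1 := no_root r hrh hQr
    have h2 := no_root _ (hrh.inv_left.mul_left (Commute.refl h)) hsQ
    have h3 := W.gap_add hQ.1 hrQ.1 hhQ'.1 hsub.subset hQr.2.subset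
    rw [← W.gap_smul r, mul_smul, smul_inv_smul] at h2
    omega
  · exact Subgroup.mem_centralizer_singleton_iff.2 hy

/-- If some `g ∈ H` translates `Q` properly and only the identity stabilises both `Q` and
`g ^ D • Q`, then `H` is cyclic or contains an element generating its own commensurator. -/
theorem exists_commensurator_eq_zpowers (W : WallFamily G F)
    (htor : ∀ (x : G) (n : ℕ), n ≠ 0 → x ^ n = 1 → x = 1) {H : Subgroup G} (hcyc : ¬ IsCyclic H)
    (hg : g ∈ H) (hQ : Q ∈ axis F g) {D : ℕ}
    (hst : ∀ x : G, x • Q = Q → x • g ^ D • Q = g ^ D • Q → x = 1) :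
    ∃ h ∈ H, h ≠ 1 ∧ {x : G | ∃ k m : ℤ, k ≠ 0 ∧ m ≠ 0 ∧ x * h ^ k * x⁻¹ = h ^ m} =
      (Subgroup.zpowers h : Set G) := by
  have hfix : ∀ y : G, (∀ R ∈ axis F g, y • R = R) → y = 1 := fun y hy => hst y (hy Q hQ)
    (hy _ (W.smul_mem_axis_of_commute hQ ((Commute.refl g).pow_left D)))
  obtain ⟨x, hxH, hxg⟩ := W.exists_mem_not_commute hfix hQ hg hcyc
  obtain ⟨d, hd, hflip⟩ := W.exists_pow_not_flips hQ x
  have hflip := hflip 1 one_ne_zero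
  rw [mul_one, Flips] at hflip
  push Not at hflip
  obtain ⟨a, c, hac⟩ := hflip
  have hXg : ¬ Commute (x ^ d) g := fun hc => hxg <| W.commute_of_commute hQ hfix hc
    (fun h1 => hxg (htor x d hd h1 ▸ Commute.one_left g)) ((Commute.refl x).pow_right d)
  have hcomm : Commute (g ^ a) (g ^ D) := ((Commute.refl g).zpow_left a).pow_right D
  obtain ⟨N, hN, hfixh, hcent⟩ := W.exists_pow_mul_centralizer (D := D) (Q := g ^ a • Q)
    (x := g ^ (a - c).toNat * x ^ d) (W.zpow_smul_mem_axis hQ a)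
    (fun y h1 h2 => by
      have := hst ((g ^ a)⁻¹ * y * g ^ a) (by rw [mul_smul, mul_smul, h1, inv_smul_smul])
        (by
          rw [smul_smul (g ^ D), ← hcomm.eq, mul_smul] at h2
          rw [mul_smul, mul_smul, h2, inv_smul_smul])
      rwa [mul_assoc, inv_mul_eq_one, eq_comm, mul_eq_right] at this)
    (by
      rw [mul_smul]
      refine (Set.smul_set_mono hac).trans ?_
      rw [smul_smul, ← zpow_natCast, ← zpow_add]
      exact zpow_smul_subset hQ (by omega))
    (fun hc => hXg (by
      have := ((Commute.refl g).pow_left (a - c).toNat).inv_left.mul_left hc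
      rwa [inv_mul_cancel_left] at this))
  set h := g ^ N * (g ^ (a - c).toNat * x ^ d)
  refine ⟨h, H.mul_mem (H.pow_mem hg _) (H.mul_mem (H.pow_mem hg _) (H.pow_mem hxH _)), ?_, ?_⟩
  · intro h1
    have := hN.2
    simp [h1] at this
  · ext y
    refine ⟨?_, ?_⟩
    · rintro ⟨k, m, hk, hm, hy⟩
      exact hcent y (W.commute_of_conj_zpow (fun z => htor z 2 two_ne_zero) hN hfixh hk hm hy)
    · rintro ⟨i, rfl⟩
      refine ⟨1, 1, one_ne_zero, one_ne_zero, ?_⟩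
      simp only [zpow_one]
      rw [(((Commute.refl h).zpow_left i).eq), mul_inv_cancel_right]

end WallFamily

end WallFamily

namespace RAAG

variable {V : Type*} {Γ : SimpleGraph V} {U : Set V} {u v w : V}

theorem fullSubgroup_induction {p : RAAG Γ → Prop} (h1 : p 1)
    (hmul : ∀ x, ∀ v ∈ U, p x ↔ p (x * raagGen Γ v)) : ∀ x ∈ fullSubgroup Γ U, p x := by
  intro x hx
  induction hx using Subgroup.closure_induction_right with
  | one => exact h1
  | mul_right x _ y hy ih =>
    obtain ⟨v, hv, rfl⟩ := hy
    exact (hmul x v hv).1 ih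
  | mul_inv_cancel x _ y hy ih =>
    obtain ⟨v, hv, rfl⟩ := hy
    rw [hmul _ v hv, inv_mul_cancel_right]
    exact ih

theorem fullSubgroup_univ : fullSubgroup Γ Set.univ = ⊤ := by
  rw [fullSubgroup, Set.image_univ]
  exact PresentedGroup.closure_range_of _

theorem induction {p : RAAG Γ → Prop} (h1 : p 1) (hmul : ∀ x v, p x ↔ p (x * raagGen Γ v))
    (x : RAAG Γ) : p x :=
  fullSubgroup_induction (U := Set.univ) h1 (fun x v _ => hmul x v) x
    (fullSubgroup_univ ▸ Subgroup.mem_top x)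

theorem gen_mem (hv : v ∈ U) : raagGen Γ v ∈ fullSubgroup Γ U :=
  Subgroup.subset_closure ⟨v, hv, rfl⟩

theorem commute_gen (h : Γ.Adj u v) : Commute (raagGen Γ u) (raagGen Γ v) := by
  have : (PresentedGroup.mk (raagRels Γ)) _ = 1 :=
    PresentedGroup.one_of_mem (rels := raagRels Γ) ⟨u, v, h, rfl⟩
  rw [map_mul, map_mul, map_mul, map_inv, map_inv, mul_inv_eq_one, mul_inv_eq_iff_eq_mul] at this
  exact this

variable (Γ) in
/-- The subgroup generated by the vertices adjacent to `v`. -/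
abbrev link (v : V) : Subgroup (RAAG Γ) := fullSubgroup Γ (Γ.neighborSet v)

theorem commute_gen_of_mem_link {x : RAAG Γ} (hx : x ∈ link Γ v) : Commute x (raagGen Γ v) := by
  have : link Γ v ≤ Subgroup.centralizer {raagGen Γ v} := by
    refine (Subgroup.closure_le _).2 ?_
    rintro _ ⟨u, hu, rfl⟩
    exact Subgroup.mem_centralizer_singleton_iff.2 (commute_gen (Γ.adj_symm hu))
  exact Subgroup.mem_centralizer_singleton_iff.1 (this hx)

open Classical in
variable (Γ) in
/-- The left translation by a generator on `RAAG Γ × ℤ`, where the second coordinate counts the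
passages through `link Γ v` by the generator `v`. -/
noncomputable def heightPerm (v w : V) : Equiv.Perm (RAAG Γ × ℤ) where
  toFun p := (raagGen Γ w * p.1, p.2 + if w = v ∧ raagGen Γ w * p.1 ∈ link Γ v then 1 else 0)
  invFun p := ((raagGen Γ w)⁻¹ * p.1, p.2 - if w = v ∧ p.1 ∈ link Γ v then 1 else 0)
  left_inv p := by simp
  right_inv p := by simp

theorem heightPerm_commute (h : Γ.Adj u w) :
    Commute (heightPerm Γ v u) (heightPerm Γ v w) := by
  ext1 p
  have hc := (commute_gen h).eq
  have hc' : raagGen Γ u * (raagGen Γ w * p.1) = raagGen Γ w * (raagGen Γ u * p.1) := by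
    rw [← mul_assoc, hc, mul_assoc]
  simp only [Equiv.Perm.mul_apply, heightPerm, Equiv.coe_fn_mk, Prod.mk.injEq]
  refine ⟨hc', ?_⟩
  by_cases hu : u = v
  · subst hu
    have hw : w ≠ u := h.ne'
    simp only [hw, false_and, if_false, true_and]
    have hmem (q : RAAG Γ) : raagGen Γ w * q ∈ link Γ u ↔ q ∈ link Γ u :=
      Subgroup.mul_mem_cancel_left _ (gen_mem h)
    rw [hc', hmem]
    ring
  · by_cases hw : w = v
    · subst hw
      simp only [hu, false_and, if_false, true_and]
      have hmem (q : RAAG Γ) : raagGen Γ u * q ∈ link Γ w ↔ q ∈ link Γ w :=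
        Subgroup.mul_mem_cancel_left _ (gen_mem h.symm)
      rw [← hc', hmem]
      ring
    · simp [hu, hw]

variable (Γ) in
/-- The homomorphism defining the height function of the hyperplane dual to the edge from `1`
to `v`. -/
noncomputable def heightHom (v : V) : RAAG Γ →* Equiv.Perm (RAAG Γ × ℤ) :=
  PresentedGroup.toGroup (f := heightPerm Γ v) (by
    rintro _ ⟨u, w, h, rfl⟩
    rw [map_mul, map_mul, map_mul, map_inv, map_inv, FreeGroup.lift_apply_of,
      FreeGroup.lift_apply_of, (heightPerm_commute h).eq]
    group)

theorem heightHom_gen (v w : V) : heightHom Γ v (raagGen Γ w) = heightPerm Γ v w :=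
  PresentedGroup.toGroup.of _

theorem heightHom_apply_fst (v : V) (x : RAAG Γ) :
    ∀ p, (heightHom Γ v x p).1 = x * p.1 := by
  induction x using RAAG.induction with
  | h1 => simp
  | hmul x w =>
    rw [← (heightPerm Γ v w).forall_congr_right]
    simp only [map_mul, heightHom_gen, Equiv.Perm.mul_apply, mul_assoc]
    rfl

variable (Γ) in
/-- The signed number of passages through `link Γ v` by the generator `v` on a path from `1`
to `x`. -/
noncomputable def height (v : V) (x : RAAG Γ) : ℤ := -(heightHom Γ v x⁻¹ (1, 0)).2

open Classical in
theorem height_mul_gen (v w : V) (x : RAAG Γ) :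
    height Γ v (x * raagGen Γ w) = height Γ v x + if w = v ∧ x ∈ link Γ v then 1 else 0 := by
  have h : x⁻¹ = raagGen Γ w * (x * raagGen Γ w)⁻¹ := by group
  rw [height, height]
  conv_rhs => rw [h]
  rw [map_mul, heightHom_gen, Equiv.Perm.mul_apply]
  simp only [heightPerm, Equiv.coe_fn_mk, heightHom_apply_fst, mul_one, ← h, inv_mem_iff]
  ring

theorem height_one (v : V) : height Γ v 1 = 0 := by simp [height]

theorem height_eq_zero {x : RAAG Γ} (h : x ∈ link Γ v) : height Γ v x = 0 := by
  refine fullSubgroup_induction (p := fun x => height Γ v x = 0) (height_one v) ?_ x h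
  intro y u hu
  have : u ≠ v := hu.ne'
  simp [height_mul_gen, this]

variable (Γ) in
/-- The side of the hyperplane dual to the edge from `1` to `v` which contains `v`. -/
def halfspace (v : V) : Set (RAAG Γ) := {x | height Γ v x = 1}

theorem mul_gen_mem_halfspace_iff {x : RAAG Γ} (h : ¬ (w = v ∧ x ∈ link Γ v)) :
    x * raagGen Γ w ∈ halfspace Γ v ↔ x ∈ halfspace Γ v := by
  simp [halfspace, height_mul_gen, h]

theorem notMem_halfspace {x : RAAG Γ} (h : x ∈ link Γ v) : x ∉ halfspace Γ v := by
  simp [halfspace, height_eq_zero h]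

theorem mul_gen_mem_halfspace {x : RAAG Γ} (h : x ∈ link Γ v) :
    x * raagGen Γ v ∈ halfspace Γ v := by
  simp [halfspace, height_mul_gen, height_eq_zero h, h]

theorem gen_mem_halfspace (v : V) : raagGen Γ v ∈ halfspace Γ v := by
  simpa using mul_gen_mem_halfspace (one_mem (link Γ v))

theorem mem_smul_set_iff {a x : RAAG Γ} {P : Set (RAAG Γ)} : x ∈ a • P ↔ a⁻¹ * x ∈ P := by
  rw [Set.mem_smul_set_iff_inv_smul_mem, smul_eq_mul]

theorem smul_halfspace_of_mem_link {a : RAAG Γ} (ha : a ∈ link Γ v) :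
    a • halfspace Γ v = halfspace Γ v := by
  have key (x : RAAG Γ) : a⁻¹ * x ∈ halfspace Γ v ↔ x ∈ halfspace Γ v := by
    have ha' := inv_mem ha
    induction x using RAAG.induction with
    | h1 => simp [notMem_halfspace ha', notMem_halfspace (one_mem (link Γ v))]
    | hmul x w =>
      rw [← mul_assoc]
      by_cases hx : w = v ∧ x ∈ link Γ v
      · obtain ⟨rfl, hx⟩ := hx
        have hax := mul_mem ha' hx
        simp only [mul_gen_mem_halfspace, notMem_halfspace, hx, hax]
      · have hax : ¬ (w = v ∧ a⁻¹ * x ∈ link Γ v) := by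
          rwa [Subgroup.mul_mem_cancel_left _ ha']
        rw [mul_gen_mem_halfspace_iff hx, mul_gen_mem_halfspace_iff hax]
  ext x
  rw [mem_smul_set_iff, key]

variable (Γ) in
/-- The sides of the hyperplanes of the Cayley graph dual to an edge with label `v`. -/
def walls (v : V) : Set (Set (RAAG Γ)) :=
  {P | ∃ a : RAAG Γ, P = a • halfspace Γ v ∨ P = (a • halfspace Γ v)ᶜ}

theorem halfspace_mem_walls (v : V) : halfspace Γ v ∈ walls Γ v := ⟨1, .inl (by simp)⟩

theorem smul_mem_walls (g : RAAG Γ) {P : Set (RAAG Γ)} (h : P ∈ walls Γ v) : g • P ∈ walls Γ v := by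
  obtain ⟨a, rfl | rfl⟩ := h
  · exact ⟨g * a, .inl (by rw [mul_smul])⟩
  · exact ⟨g * a, .inr (by rw [mul_smul, Set.smul_set_compl])⟩

theorem compl_mem_walls {P : Set (RAAG Γ)} (h : P ∈ walls Γ v) : Pᶜ ∈ walls Γ v := by
  obtain ⟨a, rfl | rfl⟩ := h
  · exact ⟨a, .inr rfl⟩
  · exact ⟨a, .inl (compl_compl _)⟩

theorem exists_smul_eq_of_mem_walls {P : Set (RAAG Γ)} (h : P ∈ walls Γ v) :
    ∃ a : RAAG Γ, a • P = halfspace Γ v ∨ a • P = (halfspace Γ v)ᶜ := by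
  obtain ⟨a, rfl | rfl⟩ := h
  · exact ⟨a⁻¹, .inl (inv_smul_smul _ _)⟩
  · exact ⟨a⁻¹, .inr (by rw [← Set.smul_set_compl, inv_smul_smul])⟩

theorem nonempty_of_mem_walls {P : Set (RAAG Γ)} (h : P ∈ walls Γ v) : P.Nonempty := by
  obtain ⟨a, rfl | rfl⟩ := h
  · exact Set.Nonempty.smul_set ⟨_, gen_mem_halfspace v⟩
  · rw [← Set.smul_set_compl]
    exact Set.Nonempty.smul_set ⟨1, notMem_halfspace (one_mem _)⟩

/-- An edge of the Cayley graph only crosses the hyperplane it is dual to. -/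
theorem mul_gen_mem_iff {P : Set (RAAG Γ)} (hP : P ∈ walls Γ v) {x : RAAG Γ}
    (h : ¬ (w = v ∧ (P = x • halfspace Γ v ∨ P = (x • halfspace Γ v)ᶜ))) :
    x * raagGen Γ w ∈ P ↔ x ∈ P := by
  obtain ⟨a, ha⟩ := hP
  have h' : ¬ (w = v ∧ a⁻¹ * x ∈ link Γ v) := by
    rintro ⟨rfl, hx⟩
    refine h ⟨rfl, ?_⟩
    have := smul_halfspace_of_mem_link hx
    rw [mul_smul, inv_smul_eq_iff] at this
    rwa [this]
  have key : x * raagGen Γ w ∈ a • halfspace Γ v ↔ x ∈ a • halfspace Γ v := by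
    rw [mem_smul_set_iff, mem_smul_set_iff, ← mul_assoc, mul_gen_mem_halfspace_iff h']
  rcases ha with rfl | rfl
  · exact key
  · exact not_congr key

theorem mem_link_iff {a : RAAG Γ} : a ∈ link Γ v ↔ a • halfspace Γ v = halfspace Γ v := by
  refine ⟨smul_halfspace_of_mem_link, fun h => ?_⟩
  by_contra ha
  have h1 := mul_gen_mem_halfspace_iff (w := v) (x := a) (fun h => ha h.2)
  rw [← h, mem_smul_set_iff, mem_smul_set_iff, inv_mul_cancel_left, inv_mul_cancel] at h1
  exact notMem_halfspace (one_mem _) (h1.1 (gen_mem_halfspace v))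

theorem finite_separating (v : V) (x y : RAAG Γ) : {P ∈ walls Γ v | x ∈ P ∧ y ∉ P}.Finite := by
  have key (x : RAAG Γ) : {P ∈ walls Γ v | ¬ (1 ∈ P ↔ x ∈ P)}.Finite := by
    induction x using RAAG.induction with
    | h1 => simp
    | hmul x w =>
      have hfin : ({x • halfspace Γ v, (x • halfspace Γ v)ᶜ} : Set (Set (RAAG Γ))).Finite := by
        simp
      have hP {P : Set (RAAG Γ)} (hP : P ∈ walls Γ v)
          (hP' : P ∉ ({x • halfspace Γ v, (x • halfspace Γ v)ᶜ} : Set (Set (RAAG Γ)))) :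
          x * raagGen Γ w ∈ P ↔ x ∈ P := mul_gen_mem_iff hP fun h => hP' h.2
      constructor
      · refine fun h => (h.union hfin).subset fun P h1 => or_iff_not_imp_right.2 fun h2 => ⟨h1.1, ?_⟩
        rw [← hP h1.1 h2]
        exact h1.2
      · refine fun h => (h.union hfin).subset fun P h1 => or_iff_not_imp_right.2 fun h2 => ⟨h1.1, ?_⟩
        rw [hP h1.1 h2]
        exact h1.2
  refine ((key x).union (key y)).subset ?_
  rintro P ⟨hP, hx, hy⟩
  by_cases h1 : 1 ∈ P
  · exact .inr ⟨hP, fun h => hy (h.1 h1)⟩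
  · exact .inl ⟨hP, fun h => h1 (h.2 hx)⟩

/-- Both sides of a hyperplane are connected. -/
theorem mem_iff_mem_of_mem_walls {R T : Set (RAAG Γ)} (hR : R ∈ walls Γ u)
    (hT : ∀ x w, x ∈ R → x * raagGen Γ w ∈ R → (x ∈ T ↔ x * raagGen Γ w ∈ T)) {x y : RAAG Γ}
    (hx : x ∈ R) (hy : y ∈ R) : x ∈ T ↔ y ∈ T := by
  obtain ⟨a, ha⟩ := exists_smul_eq_of_mem_walls hR
  have hT' (x w) (hx : x ∈ a • R) (hxw : x * raagGen Γ w ∈ a • R) :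
      x ∈ a • T ↔ x * raagGen Γ w ∈ a • T := by
    rw [mem_smul_set_iff, ← mul_assoc] at hxw
    rw [mem_smul_set_iff, mem_smul_set_iff, ← mul_assoc]
    exact hT _ w (mem_smul_set_iff.1 hx) hxw
  suffices ∃ z, ∀ x ∈ a • R, (x ∈ a • T ↔ z ∈ a • T) by
    obtain ⟨z, hz⟩ := this
    have h1 := hz _ (Set.smul_mem_smul_set hx)
    have h2 := hz _ (Set.smul_mem_smul_set hy)
    rw [Set.smul_mem_smul_set_iff] at h1 h2
    rw [h1, h2]
  generalize a • T = T at hT'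
  rcases ha with ha | ha <;> rw [ha] at hT' ⊢
  · refine ⟨raagGen Γ u, fun x => ?_⟩
    have key (x) (hx : x ∈ link Γ u) : x * raagGen Γ u ∈ T ↔ raagGen Γ u ∈ T := by
      have := fullSubgroup_induction (U := Γ.neighborSet u)
        (p := fun x => x ∈ link Γ u → (x * raagGen Γ u ∈ T ↔ raagGen Γ u ∈ T)) (by simp) ?_ x hx
      · exact this hx
      · intro y w hw
        rw [Subgroup.mul_mem_cancel_right _ (gen_mem hw)]
        refine forall_congr' fun hy => ?_
        have hc : y * raagGen Γ w * raagGen Γ u = y * raagGen Γ u * raagGen Γ w := by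
          rw [mul_assoc, mul_assoc, (commute_gen hw).eq]
        rw [hc, ← hT' _ w (mul_gen_mem_halfspace hy)]
        rw [← hc]
        exact mul_gen_mem_halfspace (mul_mem hy (gen_mem hw))
    induction x using RAAG.induction with
    | h1 => exact fun h => absurd h (notMem_halfspace (one_mem _))
    | hmul x w =>
      by_cases hx : w = u ∧ x ∈ link Γ u
      · obtain ⟨rfl, hx⟩ := hx
        exact iff_of_true (fun h => absurd h (notMem_halfspace hx)) fun _ => key x hx
      · have := mul_gen_mem_halfspace_iff hx
        rw [this]
        refine forall_congr' fun h => ?_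
        rw [hT' x w h (this.2 h)]
  · refine ⟨1, fun x => ?_⟩
    have key (x) (hx : x ∈ link Γ u) : x ∈ T ↔ 1 ∈ T := by
      have := fullSubgroup_induction (U := Γ.neighborSet u)
        (p := fun x => x ∈ link Γ u → (x ∈ T ↔ 1 ∈ T)) (by simp) ?_ x hx
      · exact this hx
      · intro y w hw
        rw [Subgroup.mul_mem_cancel_right _ (gen_mem hw)]
        refine forall_congr' fun hy => ?_
        rw [← hT' _ w (notMem_halfspace hy) (notMem_halfspace (mul_mem hy (gen_mem hw)))]
    induction x using RAAG.induction with
    | h1 => simp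
    | hmul x w =>
      by_cases hx : w = u ∧ x ∈ link Γ u
      · obtain ⟨rfl, hx⟩ := hx
        exact iff_of_true (fun h => key x hx) fun h => absurd (mul_gen_mem_halfspace hx) h
      · have := mul_gen_mem_halfspace_iff hx
        rw [Set.mem_compl_iff, Set.mem_compl_iff, this]
        refine forall_congr' fun h => ?_
        rw [hT' x w h (mt this.1 h)]

end RAAG

theorem NestedSets.symm {X : Type*} {P Q : Set X} (h : NestedSets P Q) : NestedSets Q P := by
  rcases h with h | h | h | h
  · exact .inr (.inl h)
  · exact .inl h
  · exact .inr (.inr (.inl (Set.subset_compl_comm.1 h)))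
  · exact .inr (.inr (.inr (Set.compl_subset_comm.1 h)))

theorem NestedSets.compl_right {X : Type*} {P Q : Set X} (h : NestedSets P Q) :
    NestedSets P Qᶜ := by
  rcases h with h | h | h | h
  · exact .inr (.inr (.inl (by rwa [compl_compl])))
  · exact .inr (.inr (.inr (by rwa [compl_compl])))
  · exact .inl h
  · exact .inr (.inl h)

theorem NestedSets.compl_left {X : Type*} {P Q : Set X} (h : NestedSets P Q) : NestedSets Pᶜ Q :=
  h.symm.compl_right.symm

theorem nestedSets_smul_iff {G X : Type*} [Group G] [MulAction G X] (g : G) {P Q : Set X} :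
    NestedSets (g • P) (g • Q) ↔ NestedSets P Q := by
  simp only [NestedSets, ← Set.smul_set_compl, Set.smul_set_subset_smul_set_iff]

namespace RAAG

variable {V : Type*} {Γ : SimpleGraph V} {U : Set V} {u v w : V}

theorem nestedSets_of_not_adj (h : ¬ Γ.Adj v u) {P R : Set (RAAG Γ)} (hP : P ∈ walls Γ v)
    (hR : R ∈ walls Γ u) : NestedSets P R := by
  obtain ⟨a, ha⟩ := exists_smul_eq_of_mem_walls hP
  rw [← nestedSets_smul_iff a]
  replace hR := smul_mem_walls a hR
  suffices NestedSets (halfspace Γ v) (a • R) by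
    rcases ha with ha | ha <;> rw [ha]
    exacts [this, this.compl_left]
  generalize a • R = R at hR
  wlog h1 : 1 ∉ R generalizing R
  · simpa using (this _ (compl_mem_walls hR) h1).compl_right
  have hlink (x) (hx : x ∈ link Γ v) : x ∉ R := by
    refine fullSubgroup_induction (p := fun x => x ∉ R) h1 ?_ x hx
    intro y w hw
    rw [mul_gen_mem_iff hR fun h' => h (h'.1 ▸ hw)]
  have hconn {x y} (hx : x ∈ R) (hy : y ∈ R) := mem_iff_mem_of_mem_walls (T := halfspace Γ v) hR
    (fun x w hx hxw => (mul_gen_mem_halfspace_iff fun h' => hlink x h'.2 hx).symm) hx hy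
  by_cases hW : ∃ x ∈ R, x ∈ halfspace Γ v
  · obtain ⟨x, hx, hxW⟩ := hW
    exact .inr (.inl fun y hy => (hconn hx hy).1 hxW)
  · push Not at hW
    exact .inr (.inr (.inl fun x hx hxR => hW x hxR hx))

theorem wallFamily (v : V) : WallFamily (RAAG Γ) (walls Γ v) where
  smul_mem g _ := smul_mem_walls g
  compl_mem := compl_mem_walls
  nonempty := nonempty_of_mem_walls
  nested := nestedSets_of_not_adj (Γ.loopless.irrefl v)
  finite_sep := finite_separating v

theorem mul_mem_iff_of_notMem (hv : v ∉ U) {P : Set (RAAG Γ)} (hP : P ∈ walls Γ v) (x : RAAG Γ)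
    {y : RAAG Γ} (hy : y ∈ fullSubgroup Γ U) : x * y ∈ P ↔ x ∈ P := by
  refine fullSubgroup_induction (p := fun y => x * y ∈ P ↔ x ∈ P) (by simp) ?_ y hy
  intro y w hw
  rw [← mul_assoc, mul_gen_mem_iff hP fun h => hv (h.1 ▸ hw)]

variable (Γ) in
/-- The generators and their inverses. -/
def letter (s : V × Bool) : RAAG Γ := bif s.2 then raagGen Γ s.1 else (raagGen Γ s.1)⁻¹

variable (Γ) in
/-- The side containing `letter Γ s` of the hyperplane dual to the edge from `1` to
`letter Γ s`. -/
def side (s : V × Bool) : Set (RAAG Γ) :=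
  bif s.2 then halfspace Γ s.1 else (raagGen Γ s.1)⁻¹ • (halfspace Γ s.1)ᶜ

/-- The formal inverse of a letter. -/
def flip (s : V × Bool) : V × Bool := (s.1, !s.2)

theorem letter_flip (s : V × Bool) : letter Γ (flip s) = (letter Γ s)⁻¹ := by
  rcases s with ⟨v, _ | _⟩ <;> simp [letter, flip]

theorem flip_ne (s : V × Bool) : flip s ≠ s := by simp [flip, Prod.ext_iff]

theorem side_flip (s : V × Bool) : side Γ (flip s) = (letter Γ s)⁻¹ • (side Γ s)ᶜ := by
  rcases s with ⟨v, _ | _⟩ <;> simp [letter, flip, side, Set.smul_set_compl]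

theorem letter_mem (hs : s.1 ∈ U) : letter Γ s ∈ fullSubgroup Γ U := by
  rcases s with ⟨v, _ | _⟩
  · exact inv_mem (gen_mem hs)
  · exact gen_mem hs

theorem commute_letter {a : RAAG Γ} (ha : a ∈ link Γ s.1) : Commute a (letter Γ s) := by
  rcases s with ⟨v, _ | _⟩
  · exact (commute_gen_of_mem_link ha).inv_right
  · exact commute_gen_of_mem_link ha

theorem side_mem_walls (s : V × Bool) : side Γ s ∈ walls Γ s.1 := by
  rcases s with ⟨v, _ | _⟩
  · exact smul_mem_walls _ (compl_mem_walls (halfspace_mem_walls v))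
  · exact halfspace_mem_walls v

theorem one_notMem_side (s : V × Bool) : 1 ∉ side Γ s := by
  rcases s with ⟨v, _ | _⟩
  · simp [side, mem_smul_set_iff, gen_mem_halfspace]
  · exact notMem_halfspace (one_mem _)

theorem letter_mem_side (s : V × Bool) : letter Γ s ∈ side Γ s := by
  rcases s with ⟨v, _ | _⟩
  · simp [side, letter, mem_smul_set_iff, notMem_halfspace (one_mem (link Γ v))]
  · exact gen_mem_halfspace v

theorem notMem_side_of_mem_link {a : RAAG Γ} (ha : a ∈ link Γ s.1) : a ∉ side Γ s := by
  have := mul_mem_iff_of_notMem (Γ.loopless.irrefl s.1) (side_mem_walls s) 1 ha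
  rw [one_mul] at this
  rw [this]
  exact one_notMem_side s

theorem mem_link_of_mul_inv_mem {a : RAAG Γ}
    (h : raagGen Γ v * a * (raagGen Γ v)⁻¹ ∈ link Γ v) : a ∈ link Γ v := by
  have := (commute_gen_of_mem_link h).eq
  rw [inv_mul_cancel_right, mul_right_inj] at this
  rwa [← this] at h

theorem mem_link_iff_smul_side {a : RAAG Γ} : a ∈ link Γ s.1 ↔ a • side Γ s = side Γ s := by
  rcases s with ⟨v, _ | _⟩
  · simp only [side, cond_false]
    constructor
    · intro ha
      rw [smul_smul, ((commute_gen_of_mem_link ha).inv_right).eq, mul_smul, Set.smul_set_compl,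
        smul_halfspace_of_mem_link ha]
    · intro h
      refine mem_link_of_mul_inv_mem (mem_link_iff.2 ?_)
      rwa [eq_inv_smul_iff, smul_smul, smul_smul, Set.smul_set_compl, compl_inj_iff] at h
  · exact mem_link_iff

theorem mem_link_and_eq_of_mul_letter_mem_side {x : RAAG Γ} (hx : x ∉ side Γ s)
    (hxt : x * letter Γ t ∈ side Γ s) : x ∈ link Γ s.1 ∧ t = s := by
  have key {v w : V} {x : RAAG Γ} (h1 : x ∉ halfspace Γ v)
      (h2 : x * raagGen Γ w ∈ halfspace Γ v) : w = v ∧ x ∈ link Γ v := by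
    by_contra h
    exact h1 ((mul_gen_mem_halfspace_iff h).1 h2)
  have key' {v w : V} {x : RAAG Γ} (h1 : x ∈ halfspace Γ v) :
      x * raagGen Γ w ∈ halfspace Γ v :=
    (mul_gen_mem_halfspace_iff fun h => notMem_halfspace h.2 h1).2 h1
  rcases s with ⟨v, _ | _⟩ <;> rcases t with ⟨w, _ | _⟩ <;>
    simp only [side, letter, cond_false, cond_true, mem_smul_set_iff, Set.mem_compl_iff, not_not,
      inv_inv] at hx hxt
  · rw [← mul_assoc] at hxt
    obtain ⟨rfl, h⟩ := key hxt (by rwa [inv_mul_cancel_right])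
    exact ⟨mem_link_of_mul_inv_mem h, rfl⟩
  · rw [← mul_assoc] at hxt
    exact absurd (key' hx) hxt
  · have := key' (w := w) hxt
    rw [inv_mul_cancel_right] at this
    exact absurd this hx
  · obtain ⟨rfl, h⟩ := key hx hxt
    exact ⟨h, rfl⟩

theorem mul_letter_mem_side {x : RAAG Γ} (hx : x ∈ side Γ s) : x * letter Γ s ∈ side Γ s := by
  by_contra h
  refine flip_ne s (mem_link_and_eq_of_mul_letter_mem_side (t := flip s) h ?_).2
  rwa [letter_flip, mul_inv_cancel_right]

theorem exists_list (x : RAAG Γ) : ∃ l : List (V × Bool), (l.map (letter Γ)).prod = x := by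
  induction x using RAAG.induction with
  | h1 => exact ⟨[], rfl⟩
  | hmul x v =>
    constructor
    · rintro ⟨l, rfl⟩
      exact ⟨l ++ [(v, true)], by simp [letter]⟩
    · rintro ⟨l, hl⟩
      exact ⟨l ++ [(v, false)], by simp [letter, hl]⟩

/-- The word length. -/
noncomputable def len (x : RAAG Γ) : ℕ :=
  sInf {n | ∃ l : List (V × Bool), l.length = n ∧ (l.map (letter Γ)).prod = x}

theorem exists_list_length_eq (x : RAAG Γ) :
    ∃ l : List (V × Bool), l.length = len x ∧ (l.map (letter Γ)).prod = x :=
  let ⟨l, hl⟩ := exists_list x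
  Nat.sInf_mem (s := {n | ∃ l : List (V × Bool), l.length = n ∧ (l.map (letter Γ)).prod = x})
    ⟨_, l, rfl, hl⟩

theorem len_prod_le (l : List (V × Bool)) : len (l.map (letter Γ)).prod ≤ l.length :=
  Nat.sInf_le ⟨l, rfl, rfl⟩

theorem len_mul_le (x y : RAAG Γ) : len (x * y) ≤ len x + len y := by
  obtain ⟨l, hl, rfl⟩ := exists_list_length_eq x
  obtain ⟨k, hk, rfl⟩ := exists_list_length_eq y
  rw [← hl, ← hk, ← List.length_append, ← List.prod_append, ← List.map_append]
  exact len_prod_le _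

theorem len_one : len (1 : RAAG Γ) = 0 := Nat.le_zero.1 (len_prod_le [])

theorem len_letter_le (s : V × Bool) : len (letter Γ s) ≤ 1 := by
  simpa using len_prod_le (Γ := Γ) [s]

theorem len_inv (x : RAAG Γ) : len x⁻¹ = len x := by
  have key (x : RAAG Γ) : len x⁻¹ ≤ len x := by
    obtain ⟨l, hl, rfl⟩ := exists_list_length_eq x
    rw [← hl, List.prod_inv_reverse, List.map_map]
    refine le_of_eq_of_le ?_ ((len_prod_le (Γ := Γ) (l.map flip).reverse).trans_eq (by simp))
    rw [List.map_reverse, List.map_map]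
    simp [Function.comp_def, letter_flip]
  exact (key x).antisymm (by simpa using key x⁻¹)

theorem len_lt_of_mem_side {x : RAAG Γ} (hx : x ∈ side Γ s) :
    len ((letter Γ s)⁻¹ * x) < len x := by
  have key (l : List (V × Bool)) (hl : (l.map (letter Γ)).prod ∈ side Γ s) :
      ∃ k : List (V × Bool), k.length < l.length ∧
        (k.map (letter Γ)).prod = (letter Γ s)⁻¹ * (l.map (letter Γ)).prod := by
    induction l using List.reverseRecOn with
    | nil => exact absurd hl (one_notMem_side s)
    | append_singleton l t ih =>
      simp only [List.map_append, List.map_cons, List.map_nil, List.prod_append,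
        List.prod_singleton, List.length_append, List.length_singleton] at hl ⊢
      by_cases h : (l.map (letter Γ)).prod ∈ side Γ s
      · obtain ⟨k, hk, hk'⟩ := ih h
        exact ⟨k ++ [t], by simpa using hk, by simp [hk', mul_assoc]⟩
      · obtain ⟨h1, rfl⟩ := mem_link_and_eq_of_mul_letter_mem_side h hl
        exact ⟨l, by simp, by rw [(commute_letter h1).eq, inv_mul_cancel_left]⟩
  obtain ⟨l, hl, rfl⟩ := exists_list_length_eq x
  obtain ⟨k, hk, hk'⟩ := key l hx
  rw [← hl, ← hk']
  exact (len_prod_le k).trans_lt hk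

theorem lt_len_of_notMem_side {x : RAAG Γ} (hx : x ∉ side Γ s) :
    len x < len ((letter Γ s)⁻¹ * x) := by
  have h : (letter Γ s)⁻¹ * x ∈ side Γ (flip s) := by
    rw [side_flip, mem_smul_set_iff, inv_inv, mul_inv_cancel_left]
    exact hx
  simpa [letter_flip] using len_lt_of_mem_side h

theorem mem_side_of_cons {x : RAAG Γ} {l : List (V × Bool)}
    (h : ((s :: l).map (letter Γ)).prod = x) (hl : l.length < len x) :
    x ∈ side Γ s := by
  by_contra hx
  have h1 := lt_len_of_notMem_side hx
  have h2 := len_prod_le (Γ := Γ) l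
  rw [← h, List.map_cons, List.prod_cons, inv_mul_cancel_left] at h1
  rw [List.map_cons, List.prod_cons] at h
  rw [h] at h1
  omega

theorem exists_mem_side {x : RAAG Γ} (hx : x ≠ 1) : ∃ s, x ∈ side Γ s := by
  obtain ⟨l, hl, h⟩ := exists_list_length_eq x
  match l with
  | [] => exact absurd h.symm hx
  | s :: l => exact ⟨s, mem_side_of_cons h (by rw [← hl]; simp)⟩

theorem smul_side_ssubset {x : RAAG Γ} (hx : x ∈ side Γ s) (hx' : x⁻¹ ∉ side Γ s) :
    x • side Γ s ⊂ side Γ s := by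
  have h1 : x ∉ x • side Γ s := by
    rw [mem_smul_set_iff, inv_mul_cancel]
    exact one_notMem_side s
  have h2 : (1 : RAAG Γ) ∉ x • side Γ s := by rwa [mem_smul_set_iff, mul_one]
  refine ⟨?_, fun h => h1 (h hx)⟩
  rcases (wallFamily s.1).nested (smul_mem_walls x (side_mem_walls s)) (side_mem_walls s)
    with h | h | h | h
  · exact h
  · exact absurd (h hx) h1
  · exact absurd (mul_letter_mem_side hx) (h (Set.smul_mem_smul_set (letter_mem_side s)))
  · exact absurd (h (one_notMem_side s)) h2

/-- The labels of the hyperplanes which an element translates properly. -/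
def ess (g : RAAG Γ) : Set V := {v | (axis (walls Γ v) g).Nonempty}

theorem ess_pow (g : RAAG Γ) {n : ℕ} (hn : n ≠ 0) : ess (g ^ n) = ess g := by
  ext v
  rw [ess, ess, Set.mem_ofPred_eq, Set.mem_ofPred_eq, (wallFamily v).axis_pow hn]

theorem ess_conj (a g : RAAG Γ) : ess (a * g * a⁻¹) = ess g := by
  have key (a g : RAAG Γ) : ess g ⊆ ess (a * g * a⁻¹) := by
    rintro v ⟨P, hP, hgP⟩
    refine ⟨a • P, smul_mem_walls a hP, ?_⟩
    rwa [mul_smul, inv_smul_smul, mul_smul, smul_set_ssubset_smul_set_iff]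
  refine Set.Subset.antisymm ?_ (key a g)
  have := key a⁻¹ (a * g * a⁻¹)
  convert this using 2
  group

theorem ess_inv (g : RAAG Γ) : ess g⁻¹ = ess g := by
  have key (g : RAAG Γ) : ess g ⊆ ess g⁻¹ :=
    fun v ⟨P, hP⟩ => ⟨Pᶜ, axis_inv compl_mem_walls hP⟩
  exact (by simpa using key g⁻¹ : ess g⁻¹ ⊆ ess g).antisymm (key g)

theorem ess_subset {g : RAAG Γ} (hg : g ∈ fullSubgroup Γ U) : ess g ⊆ U := by
  rintro v ⟨P, hP⟩
  by_contra hv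
  have mem {x : RAAG Γ} (hx : x ∈ fullSubgroup Γ U) : x ∈ P ↔ 1 ∈ P := by
    rw [← mul_mem_iff_of_notMem hv hP.1 1 hx, one_mul]
  obtain ⟨n, hn⟩ := (wallFamily v).exists_notMem_pow_smul hP 1
  obtain ⟨m, hm⟩ := (wallFamily v).exists_mem_inv_pow_smul hP 1
  rw [mem_smul_set_iff, mul_one] at hn hm
  rw [mem (inv_mem (pow_mem hg n))] at hn
  rw [mem (inv_mem (inv_mem (pow_mem hg m)))] at hm
  exact hn hm

theorem mem_ess_of_mem_side {g : RAAG Γ} (h : g ∈ side Γ s) (h' : g⁻¹ ∉ side Γ s) : s.1 ∈ ess g :=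
  ⟨side Γ s, side_mem_walls s, smul_side_ssubset h h'⟩

theorem mem_fullSubgroup_ess_of_forall_len_le {g : RAAG Γ}
    (hg : ∀ a : RAAG Γ, len g ≤ len (a * g * a⁻¹)) : g ∈ fullSubgroup Γ (ess g) := by
  have mem_ess {g : RAAG Γ} (hg : ∀ a : RAAG Γ, len g ≤ len (a * g * a⁻¹)) {s : V × Bool}
      (hs : g ∈ side Γ s) : s.1 ∈ ess g := by
    refine mem_ess_of_mem_side hs fun hs' => ?_
    have h1 := len_lt_of_mem_side hs'
    rw [← mul_inv_rev, len_inv, len_inv] at h1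
    have h2 := len_lt_of_mem_side (mul_letter_mem_side hs)
    have h3 := hg (letter Γ s)⁻¹
    rw [inv_inv, mul_assoc] at h3
    omega
  obtain ⟨l, hl, hlg⟩ := exists_list_length_eq g
  suffices ∀ s ∈ l, s.1 ∈ ess g by
    rw [← hlg]
    refine list_prod_mem fun x hx => ?_
    obtain ⟨s, hs, rfl⟩ := List.mem_map.1 hx
    rw [hlg]
    exact letter_mem (this s hs)
  intro s hs
  obtain ⟨k, k', rfl⟩ := List.append_of_mem hs
  set b := (k.map (letter Γ)).prod with hb
  have hrot : ((s :: (k' ++ k)).map (letter Γ)).prod = b⁻¹ * g * b⁻¹⁻¹ := by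
    rw [← hlg]
    simp [hb, mul_assoc]
  have hlen : len g ≤ len (b⁻¹ * g * b⁻¹⁻¹) := hg _
  rw [← ess_conj b⁻¹ g]
  refine mem_ess (fun a => ?_) (mem_side_of_cons hrot ?_)
  · refine le_trans ?_ ((hg (a * b⁻¹)).trans_eq ?_)
    · rw [← hl, ← hrot]
      refine (len_prod_le _).trans_eq ?_
      simp only [List.length_append, List.length_cons]
      omega
    · congr 1
      group
  · refine lt_of_lt_of_le ?_ hlen
    rw [← hl]
    simp only [List.length_append, List.length_cons]
    omega

theorem exists_conj_mem_fullSubgroup_ess (g : RAAG Γ) :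
    ∃ a : RAAG Γ, a * g * a⁻¹ ∈ fullSubgroup Γ (ess g) := by
  obtain ⟨a, -, ha⟩ := exists_minimalFor_of_wellFoundedLT (fun _ : RAAG Γ => True)
    (fun a => len (a * g * a⁻¹)) ⟨1, trivial⟩
  refine ⟨a, ?_⟩
  rw [← ess_conj a g]
  refine mem_fullSubgroup_ess_of_forall_len_le fun b => ?_
  have : b * (a * g * a⁻¹) * b⁻¹ = b * a * g * (b * a)⁻¹ := by group
  rw [this]
  exact (le_total _ _).elim id (ha (j := b * a) trivial)

theorem eq_one_of_ess_eq_empty {g : RAAG Γ} (hg : ess g = ∅) : g = 1 := by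
  obtain ⟨a, ha⟩ := exists_conj_mem_fullSubgroup_ess g
  rw [hg, fullSubgroup, Set.image_empty, Subgroup.closure_empty, Subgroup.mem_bot,
    conj_eq_one_iff] at ha
  exact ha

theorem exists_eq_mul_of_len (U : Set V) (x : RAAG Γ) :
    ∃ b ∈ fullSubgroup Γ U, ∃ y : RAAG Γ, x = b * y ∧ len b + len y ≤ len x ∧
      ∀ s : V × Bool, s.1 ∈ U → y ∉ side Γ s := by
  induction hn : len x using Nat.strong_induction_on generalizing x with
  | _ n ih =>
    subst hn
    by_cases h : ∃ s : V × Bool, s.1 ∈ U ∧ x ∈ side Γ s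
    · obtain ⟨s, hs, hx⟩ := h
      have hlt := len_lt_of_mem_side hx
      obtain ⟨b, hb, y, hy, hlen, hys⟩ := ih _ hlt _ rfl
      refine ⟨letter Γ s * b, mul_mem (letter_mem hs) hb, y, ?_, ?_, hys⟩
      · rw [mul_assoc, ← hy, mul_inv_cancel_left]
      · have := len_mul_le (letter Γ s) b
        have := len_letter_le (Γ := Γ) s
        omega
    · push Not at h
      exact ⟨1, one_mem _, x, (one_mul x).symm, by rw [len_one, zero_add], h⟩

theorem mem_link_of_mem_side_of_pow_mem {x : RAAG Γ} {m : ℕ} (hs : s.1 ∉ U)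
    (hxm : x ^ m ∈ fullSubgroup Γ U) (hx : x ∈ side Γ s) (hx' : x⁻¹ ∈ side Γ s) :
    x ^ m ∈ link Γ s.1 := by
  have W := wallFamily (Γ := Γ) s.1
  have hP := side_mem_walls (Γ := Γ) s
  have hess : s.1 ∉ ess (x ^ m) := fun h => hs (ess_subset hxm h)
  have hxP : (x • side Γ s)ᶜ ⊆ side Γ s := by
    rcases W.nested (smul_mem_walls x hP) hP with h | h | h | h
    · refine absurd (h (Set.smul_mem_smul_set hx')) ?_
      rw [smul_eq_mul, mul_inv_cancel]
      exact one_notMem_side s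
    · have := h hx
      rw [mem_smul_set_iff, inv_mul_cancel] at this
      exact absurd this (one_notMem_side s)
    · exact absurd (mul_letter_mem_side hx) (h (Set.smul_mem_smul_set (letter_mem_side s)))
    · exact Set.compl_subset_comm.1 h
  have h1 (z : RAAG Γ) (hz : z ∈ fullSubgroup Γ U) : z ∉ side Γ s := by
    rw [← one_mul z, mul_mem_iff_of_notMem hs hP 1 hz]
    exact one_notMem_side s
  rw [mem_link_iff_smul_side]
  rcases W.nested (smul_mem_walls (x ^ m) hP) hP with h | h | h | h
  · exact h.eq_or_ssubset.resolve_right fun h' => hess ⟨_, hP, h'⟩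
  · refine (h.eq_or_ssubset.resolve_right fun h' => hess ?_).symm
    rw [← ess_inv]
    refine ⟨_, hP, ?_⟩
    rwa [← smul_set_ssubset_smul_set_iff (x ^ m), smul_inv_smul]
  · exfalso
    have h2 : x ^ m * x ∈ side Γ s := by
      rw [← pow_succ, pow_succ', mul_mem_iff_of_notMem hs hP x hxm]
      exact hx
    have h3 : x ∉ x • side Γ s := by
      rw [mem_smul_set_iff, inv_mul_cancel]
      exact one_notMem_side s
    exact h (Set.smul_mem_smul_set (hxP h3)) h2
  · refine absurd (h (one_notMem_side s)) ?_
    rw [mem_smul_set_iff, mul_one]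
    exact h1 _ (inv_mem hxm)

theorem mem_fullSubgroup_of_pow_mem {x : RAAG Γ} {m : ℕ} (hm : m ≠ 0)
    (hxm : x ^ m ∈ fullSubgroup Γ U) : x ∈ fullSubgroup Γ U := by
  induction hn : len x using Nat.strong_induction_on generalizing x U with
  | _ n ih =>
    subst hn
    obtain ⟨b, hb, y, rfl, hlen, hys⟩ := exists_eq_mul_of_len U x
    by_cases hy1 : y = 1
    · rwa [hy1, mul_one]
    exfalso
    obtain ⟨s, hs⟩ := exists_mem_side hy1
    have hsU : s.1 ∉ U := fun h => hys s h hs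
    have hconj : (y * b) ^ m = b⁻¹ * (b * y) ^ m * b := by
      have := conj_pow (i := m) (a := b⁻¹) (b := b * y)
      rw [inv_mul_cancel_left, inv_inv] at this
      exact this
    have hm' : (y * b) ^ m ∈ fullSubgroup Γ U := by
      rw [hconj]
      exact mul_mem (mul_mem (inv_mem hb) hxm) hb
    have h1 : y * b ∈ side Γ s := (mul_mem_iff_of_notMem hsU (side_mem_walls s) y hb).2 hs
    have h2 : (y * b)⁻¹ ∈ side Γ s := by
      by_contra h2
      have := mem_ess_of_mem_side h1 h2
      rw [← ess_pow _ hm] at this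
      exact hsU (ess_subset hm' this)
    have hlink := mem_link_of_mem_side_of_pow_mem hsU hm' h1 h2
    have h3 := len_lt_of_mem_side h2
    rw [← mul_inv_rev, len_inv, len_inv] at h3
    have h4 := len_lt_of_mem_side (mul_letter_mem_side h1)
    have h5 := len_mul_le y b
    have hpow : ((letter Γ s)⁻¹ * (y * b * letter Γ s)) ^ m = (y * b) ^ m := by
      have := conj_pow (i := m) (a := (letter Γ s)⁻¹) (b := y * b)
      rw [inv_inv, mul_assoc, mul_assoc _ (_ ^ _), (commute_letter hlink).eq,
        inv_mul_cancel_left] at this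
      exact this
    have h6 : (letter Γ s)⁻¹ * (y * b * letter Γ s) ∈ link Γ s.1 :=
      ih _ (by omega) (hpow ▸ hlink) rfl
    have h7 := (commute_letter h6).eq
    rw [mul_inv_cancel_left, mul_left_inj] at h7
    exact notMem_side_of_mem_link (h7 ▸ h6) h1

theorem eq_one_of_pow_eq_one {x : RAAG Γ} {m : ℕ} (hm : m ≠ 0) (hx : x ^ m = 1) : x = 1 := by
  have : x ∈ fullSubgroup Γ ∅ := mem_fullSubgroup_of_pow_mem hm (hx ▸ one_mem _)
  simpa [fullSubgroup] using this

theorem commute_of_mem_fullSubgroup {W : Set V} (h : ∀ u ∈ U, ∀ v ∈ W, Γ.Adj u v) {a b : RAAG Γ}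
    (ha : a ∈ fullSubgroup Γ U) (hb : b ∈ fullSubgroup Γ W) : Commute a b := by
  have hgen {u : V} (hu : u ∈ U) : Commute b (raagGen Γ u) := by
    refine commute_gen_of_mem_link (Subgroup.closure_mono ?_ hb)
    exact Set.image_mono fun v hv => h u hu v hv
  have : fullSubgroup Γ U ≤ Subgroup.centralizer {b} := by
    rw [fullSubgroup, Subgroup.closure_le]
    rintro _ ⟨u, hu, rfl⟩
    exact Subgroup.mem_centralizer_singleton_iff.2 (hgen hu).symm.eq
  exact Subgroup.mem_centralizer_singleton_iff.1 (this ha)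

open Filter in
theorem exists_eventually_mem_ess {w x : RAAG Γ} (hw : w ∈ fullSubgroup Γ (ess w))
    (hx : x ∉ fullSubgroup Γ (ess w)) :
    ∃ v ∉ ess w, ∀ᶠ n : ℕ in atTop, v ∈ ess (w ^ n * x) := by
  set U := ess w with hU
  set W : Set V := {v | ∀ u ∈ U, Γ.Adj u v} with hW
  have hcomm {a b : RAAG Γ} (ha : a ∈ fullSubgroup Γ U) (hb : b ∈ fullSubgroup Γ W) :
      Commute a b := commute_of_mem_fullSubgroup (W := W) (fun u hu v hv => hv u hu) ha hb
  obtain ⟨t, ⟨b, hb, a, ha, c, hc, rfl⟩, hmin⟩ := exists_minimalFor_of_wellFoundedLT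
    (fun t : RAAG Γ => ∃ b ∈ fullSubgroup Γ U, ∃ a ∈ fullSubgroup Γ W, ∃ c ∈ fullSubgroup Γ U,
      x = b * (a * t * a⁻¹) * c) len
    ⟨x, 1, one_mem _, 1, one_mem _, 1, one_mem _, by simp⟩
  have ht : t ≠ 1 := by
    rintro rfl
    rw [mul_one, mul_inv_cancel, mul_one] at hx
    exact hx (mul_mem hb hc)
  obtain ⟨s, hs⟩ := exists_mem_side ht
  have hmin' {t' : RAAG Γ} (hlt : len t' < len t) {b' a' : RAAG Γ} (hb' : b' ∈ fullSubgroup Γ U)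
      (ha' : a' ∈ fullSubgroup Γ W) : b * (a * t * a⁻¹) * c ≠ b' * (a' * t' * a'⁻¹) * c :=
    fun h => hlt.not_ge (hmin ⟨b', hb', a', ha', c, hc, h⟩ hlt.le)
  have hsU : s.1 ∉ U := by
    intro h
    refine hmin' (len_lt_of_mem_side hs) (mul_mem hb (letter_mem h)) ha ?_
    have := (hcomm (letter_mem h) ha).eq
    rw [mul_assoc b (letter Γ s), ← mul_assoc (letter Γ s), ← mul_assoc (letter Γ s), this,
      mul_assoc a (letter Γ s), mul_inv_cancel_left]
  refine ⟨s.1, hsU, ?_⟩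
  set k : ℕ → RAAG Γ := fun n => c * w ^ n * b with hk
  have hkU (n : ℕ) : k n ∈ fullSubgroup Γ U := mul_mem (mul_mem hc (pow_mem hw n)) hb
  have hess (n : ℕ) : ess (w ^ n * (b * (a * t * a⁻¹) * c)) = ess (t * k n) := by
    rw [← ess_conj (a⁻¹ * c), ← ess_conj (k n) (t * k n)]
    congr 1
    calc _ = a⁻¹ * (k n * a) * t := by simp only [hk]; group
      _ = _ := by rw [(hcomm (hkU n) ha).eq]; group
  have hside (n : ℕ) (h : t⁻¹ ∉ k n • side Γ s) : s.1 ∈ ess (w ^ n * (b * (a * t * a⁻¹) * c)) := by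
    rw [hess]
    refine mem_ess_of_mem_side ((mul_mem_iff_of_notMem hsU (side_mem_walls s) t (hkU n)).2 hs) ?_
    rwa [mul_inv_rev, ← mem_smul_set_iff]
  by_cases hsW : s.1 ∈ W
  · refine .of_forall fun n => hside n fun h => ?_
    have hlink : k n ∈ link Γ s.1 :=
      Subgroup.closure_mono (Set.image_mono fun u hu => (hsW u hu).symm) (hkU n)
    rw [mem_link_iff_smul_side.1 hlink] at h
    have h3 := len_lt_of_mem_side h
    rw [← mul_inv_rev, len_inv, len_inv] at h3
    have h4 := len_lt_of_mem_side (mul_letter_mem_side hs)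
    refine hmin' (h4.trans h3) hb (mul_mem ha (letter_mem hsW)) ?_
    group
  · have hinj : Function.Injective fun n => k n • side Γ s := by
      refine .of_lt_imp_ne fun n m hnm h => hsW fun u hu => ?_
      have hlink : b⁻¹ * w ^ (m - n) * b⁻¹⁻¹ ∈ link Γ s.1 := by
        rw [mem_link_iff_smul_side, ← smul_left_cancel_iff (k n), smul_smul]
        refine Eq.trans ?_ h.symm
        congr 1
        simp only [hk]
        rw [← Nat.add_sub_of_le hnm.le, pow_add, Nat.add_sub_cancel_left]
        group
      have := ess_subset hlink
      rw [ess_conj, ess_pow _ (by omega)] at this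
      exact (this hu).symm
    have hfin : {n | t⁻¹ ∈ k n • side Γ s}.Finite := by
      refine ((finite_separating s.1 t⁻¹ 1).preimage hinj.injOn).subset fun n hn => ?_
      refine ⟨smul_mem_walls _ (side_mem_walls s), hn, ?_⟩
      rw [mem_smul_set_iff, mul_one, ← one_mul (k n)⁻¹,
        mul_mem_iff_of_notMem hsU (side_mem_walls s) 1 (inv_mem (hkU n))]
      exact one_notMem_side s
    have := hfin.compl_mem_cofinite
    rw [Nat.cofinite_eq_atTop] at this
    filter_upwards [this] with n hn
    exact hside n hn

open Filter in
theorem eventually_mem_ess {w x : RAAG Γ} {Q : Set (RAAG Γ)} (hQ : Q ∈ axis (walls Γ u) w)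
    (hx : ¬ Flips w Q x) : ∀ᶠ n : ℕ in atTop, u ∈ ess (w ^ n * x) := by
  simp only [Flips, not_forall, not_not] at hx
  obtain ⟨a, c, h⟩ := hx
  filter_upwards [eventually_gt_atTop (a - c).toNat] with n hn
  refine ⟨_, smul_mem_walls (w ^ a) hQ.1, ?_⟩
  rw [mul_smul]
  refine (Set.smul_set_mono h).trans_ssubset ?_
  rw [← zpow_natCast, smul_smul, ← zpow_add]
  exact WallFamily.zpow_smul_ssubset hQ (by omega)

open Filter in
theorem exists_ess_eq_univ [Finite V] {H : Subgroup (RAAG Γ)}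
    (hpar : ∀ (a : RAAG Γ) (U : Set V), U ≠ Set.univ →
      ¬ H ≤ (fullSubgroup Γ U).map (MulAut.conj a).toMonoidHom) :
    ∃ g ∈ H, ess g = Set.univ := by
  obtain ⟨g, hg, hmax⟩ := (Set.toFinite (ess '' (H : Set (RAAG Γ)))).exists_maximalFor id _
    ⟨_, 1, H.one_mem, rfl⟩
  obtain ⟨g, hgH, rfl⟩ := hg
  refine ⟨g, hgH, ?_⟩
  by_contra hU
  obtain ⟨p, hp⟩ := exists_conj_mem_fullSubgroup_ess g
  obtain ⟨x, hxH, hx⟩ := SetLike.not_le_iff_exists.1 (hpar p⁻¹ _ hU)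
  have hx' : p * x * p⁻¹ ∉ fullSubgroup Γ (ess g) := by
    refine fun h => hx ⟨_, h, ?_⟩
    simp [mul_assoc]
  rw [← ess_conj p g] at hp hx'
  have hd (u : V) : ∃ d : ℕ, d ≠ 0 ∧ (u ∈ ess (p * g * p⁻¹) → ∃ Q ∈ axis (walls Γ u) (p * g * p⁻¹),
      ∀ k ≠ 0, ¬ Flips (p * g * p⁻¹) Q ((p * x * p⁻¹) ^ (d * k))) := by
    by_cases hu : u ∈ ess (p * g * p⁻¹)
    · obtain ⟨Q, hQ⟩ := hu
      obtain ⟨d, hd, h⟩ := (wallFamily u).exists_pow_not_flips hQ (p * x * p⁻¹)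
      exact ⟨d, hd, fun _ => ⟨Q, hQ, h⟩⟩
    · exact ⟨1, one_ne_zero, fun h => absurd h hu⟩
  choose d hd0 hd using hd
  have := Fintype.ofFinite V
  set m := ∏ u, d u with hm
  have hm0 : m ≠ 0 := Finset.prod_ne_zero_iff.2 fun u _ => hd0 u
  obtain ⟨v, hv, hvess⟩ := exists_eventually_mem_ess hp
    fun h => hx' (mem_fullSubgroup_of_pow_mem hm0 h)
  have hess : ∀ᶠ n : ℕ in atTop, ∀ u ∈ ess (p * g * p⁻¹),
      u ∈ ess ((p * g * p⁻¹) ^ n * (p * x * p⁻¹) ^ m) := by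
    refine (eventually_all_finite (Set.toFinite _)).2 fun u hu => ?_
    obtain ⟨Q, hQ, hk⟩ := hd u hu
    obtain ⟨k, hk'⟩ := Finset.dvd_prod_of_mem d (Finset.mem_univ u)
    refine eventually_mem_ess hQ ?_
    rw [hm, hk']
    refine hk k ?_
    rintro rfl
    exact hm0 (by rw [hm, hk', mul_zero])
  obtain ⟨n, hn, hn'⟩ := (hvess.and hess).exists
  have heq : ess ((p * g * p⁻¹) ^ n * (p * x * p⁻¹) ^ m) = ess (g ^ n * x ^ m) := by
    rw [conj_pow, conj_pow, ← ess_conj p (g ^ n * x ^ m)]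
    congr 1
    group
  rw [heq] at hn
  rw [heq, ess_conj] at hn'
  rw [ess_conj] at hv
  exact hv (hmax ⟨_, mul_mem (pow_mem hgH n) (pow_mem hxH m), rfl⟩ hn' hn)

end RAAG

/-- An element stabilising `A` and `B` fixes every member of `F` between them. -/
theorem WallFamily.smul_eq_of_between {G X : Type*} [Group G] [MulAction G X] {F : Set (Set X)}
    (W : WallFamily G F) {x : G} {A B P : Set X} (hA : Aᶜ.Nonempty) (hB : B.Nonempty)
    (hxA : x • A = A) (hxB : x • B = B) (hP : P ∈ F) (hBP : B ⊆ P) (hPA : P ⊆ A) : x • P = P := by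
  have key {y : G} (hyB : y • B = B) (h : y • P ⊆ P) : y • P = P := by
    by_contra hne
    obtain ⟨b, hb⟩ := hB
    obtain ⟨n, hn⟩ := W.exists_notMem_pow_smul ⟨hP, h.ssubset_of_ne hne⟩ b
    have hyn (n : ℕ) : y ^ n • B = B := by
      induction n with
      | zero => simp
      | succ n ih => rw [pow_succ, mul_smul, hyB, ih]
    exact hn (Set.smul_set_mono hBP ((hyn n).symm ▸ hb))
  obtain ⟨a, ha⟩ := hA
  have hxP : x • P ⊆ A := hxA ▸ Set.smul_set_mono hPA
  have hxP' : B ⊆ x • P := hxB ▸ Set.smul_set_mono hBP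
  rcases W.nested (W.smul_mem x hP) hP with h | h | h | h
  · exact key hxB h
  · have := key (y := x⁻¹) (by rw [inv_smul_eq_iff, hxB])
      (by rwa [← Set.subset_smul_set_iff])
    rw [inv_smul_eq_iff] at this
    exact this.symm
  · obtain ⟨b, hb⟩ := hB
    exact absurd (hBP hb) (h (hxP' hb))
  · exact absurd (hPA (by_contra fun h' => ha (hxP (h h')))) ha

namespace RAAG

variable {V : Type*} {Γ : SimpleGraph V}

theorem exists_pow_smul_subset_of_graphIrreducible (hirr : GraphIrreducible Γ) {g : RAAG Γ}
    {P : V → Set (RAAG Γ)} (hP : ∀ v, P v ∈ axis (walls Γ v) g) (u v : V) :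
    ∃ n : ℕ, g ^ n • P u ⊆ P v := by
  have step {v w : V} (h : ¬ Γ.Adj v w) : ∃ n : ℕ, g ^ n • P v ⊆ P w :=
    exists_pow_smul_subset (nonempty_of_mem_walls (hP v).1) (nonempty_of_mem_walls (hP w).1)
      (nonempty_of_mem_walls (compl_mem_walls (hP w).1)) (hP v).2.subset
      ((wallFamily v).exists_notMem_pow_smul (hP v)) ((wallFamily w).exists_mem_inv_pow_smul (hP w))
      fun n => nestedSets_of_not_adj h (smul_mem_walls _ (hP v).1) (hP w).1
  by_contra hv
  refine hirr ⟨{w | ∃ n : ℕ, g ^ n • P u ⊆ P w}, ⟨u, 0, by simp⟩, ⟨v, hv⟩, ?_⟩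
  rintro a ⟨n, hn⟩ b hb
  by_contra hab
  obtain ⟨m, hm⟩ := step hab
  refine hb ⟨m + n, ?_⟩
  rw [pow_add, mul_smul]
  exact (Set.smul_set_mono hn).trans hm

theorem exists_forall_smul_eq_imp_eq_one [Finite V] (hirr : GraphIrreducible Γ) {g : RAAG Γ}
    (hg : ess g = Set.univ) (v : V) : ∃ P ∈ axis (walls Γ v) g, ∃ D : ℕ, ∀ x : RAAG Γ,
      x • P = P → x • g ^ D • P = g ^ D • P → x = 1 := by
  have hP (u : V) : u ∈ ess g := hg ▸ Set.mem_univ u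
  choose P hP using hP
  have hsub := exists_pow_smul_subset_of_graphIrreducible hirr hP
  choose i hi using fun u => hsub u v
  choose k hk using hsub v
  have := Fintype.ofFinite V
  refine ⟨P v, hP v, ∑ u, (i u + k u), fun x hx hx' => eq_one_of_ess_eq_empty ?_⟩
  refine Set.eq_empty_of_forall_notMem fun u ⟨R, hR⟩ => ?_
  have hgP : g ^ i u • P u ∈ walls Γ u := smul_mem_walls _ (hP u).1
  refine (wallFamily u).smul_ne_of_mem_axis hR hgP ?_
  refine (wallFamily u).smul_eq_of_between (nonempty_of_mem_walls (compl_mem_walls (hP v).1))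
    (nonempty_of_mem_walls (smul_mem_walls _ (hP v).1)) hx hx' hgP ?_ (hi u)
  refine (pow_smul_subset_pow_smul (hP v).2.subset
    (Finset.single_le_sum (f := fun u => i u + k u) (fun _ _ => Nat.zero_le _)
      (Finset.mem_univ u))).trans ?_
  rw [pow_add, mul_smul]
  exact Set.smul_set_mono (hk u)

end RAAG

theorem Subgroup.center_eq_bot_of_commensurator {G : Type*} [Group G] {H : Subgroup G}
    (hcyc : ¬ IsCyclic H) {h : G} (hH : h ∈ H)
    (hE : {x : G | ∃ k m : ℤ, k ≠ 0 ∧ m ≠ 0 ∧ x * h ^ k * x⁻¹ = h ^ m} = (zpowers h : Set G)) :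
    center H = ⊥ := by
  have mem {x : G} {k : ℤ} (hk : k ≠ 0) (hx : Commute x (h ^ k)) : x ∈ zpowers h := by
    rw [← SetLike.mem_coe, ← hE]
    exact ⟨k, k, hk, hk, by rw [hx.eq, mul_inv_cancel_right]⟩
  refine (Subgroup.eq_bot_iff_forall _).2 fun z hz => ?_
  rw [mem_center_iff] at hz
  have hz' (x : G) (hx : x ∈ H) : Commute x z := congrArg Subtype.val (hz ⟨x, hx⟩)
  obtain ⟨k, hk⟩ := mem_zpowers_iff.1 (mem one_ne_zero (by simpa using (hz' h hH).symm))
  by_contra hz1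
  have hk0 : k ≠ 0 := by
    rintro rfl
    exact hz1 (Subtype.ext (by rw [← hk, zpow_zero, coe_one]))
  refine hcyc (isCyclic_of_le (H' := zpowers h) fun x hx => mem hk0 ?_)
  rw [hk]
  exact hz' x hx

end

/-- If `Γ` is a finite irreducible graph and `H` is a non-cyclic subgroup of
`A = A(Γ)` contained in no proper parabolic subgroup, then `H` has trivial center
and contains a nontrivial element `h` with `E_A(h) = ⟨h⟩ ⊆ H`. -/
theorem center_trivial_and_special_element_exists
    {V : Type*} [Fintype V] (Γ : SimpleGraph V) (hirr : GraphIrreducible Γ)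
    (H : Subgroup (RAAG Γ)) (hcyc : ¬ IsCyclic H)
    (hpar : ∀ (a : RAAG Γ) (U : Set V), U ≠ Set.univ →
      ¬ H ≤ (fullSubgroup Γ U).map (MulAut.conj a).toMonoidHom) :
    Subgroup.center H = ⊥ ∧
    ∃ h : RAAG Γ, h ∈ H ∧ h ≠ 1 ∧
      {x : RAAG Γ | ∃ k m : ℤ, k ≠ 0 ∧ m ≠ 0 ∧ x * h ^ k * x⁻¹ = h ^ m}
        = (Subgroup.zpowers h : Set (RAAG Γ)) ∧
      Subgroup.zpowers h ≤ H := by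
  obtain ⟨g, hgH, hg⟩ := RAAG.exists_ess_eq_univ hpar
  obtain ⟨v⟩ : Nonempty V := by
    by_contra! hV
    have h1 (x : RAAG Γ) : x = 1 := RAAG.eq_one_of_ess_eq_empty (Set.eq_empty_of_isEmpty _)
    have : Subsingleton H := ⟨fun x y => Subtype.ext ((h1 x).trans (h1 y).symm)⟩
    exact hcyc inferInstance
  obtain ⟨P, hP, D, hst⟩ := RAAG.exists_forall_smul_eq_imp_eq_one hirr hg v
  obtain ⟨h, hH, h1, hE⟩ := (RAAG.wallFamily v).exists_commensurator_eq_zpowers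
    (fun _ _ => RAAG.eq_one_of_pow_eq_one) hcyc hgH hP hst
  exact ⟨Subgroup.center_eq_bot_of_commensurator hcyc hH hE, h, hH, h1, hE,
    Subgroup.zpowers_le.2 hH⟩
end

section
/- Let δ ≥ 0, let S be a δ-hyperbolic geodesic metric space, let the group G act on S by isometries, let s ∈ S and let Q be a subgroup of G. Then the following are equivalent: (1) there exists σ ≥ 0 such that the orbit Q • s = {q • s : q ∈ Q} is σ-quasi-convex, and the action of Q on S is metrically proper; (2) there exist a finite subset Y ⊆ Q generating Q and constants μ ≥ 1 and c ≥ 0 such that every g ∈ Q can be written as a product g = y₁ * ⋯ * y_k with each y_j ∈ Y ∪ Y⁻¹ and (k : ℝ) ≤ μ * dist s (g • s) + c. -/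
/-- `γ` is a geodesic from `x` to `y`: an isometric embedding of the interval
`[0, dist x y]` sending the endpoints to `x` and `y`. -/
def IsGeodesic {S : Type*} [MetricSpace S] {x y : S}
    (γ : Set.Icc (0 : ℝ) (dist x y) → S) : Prop :=
  Isometry γ ∧ γ ⟨0, le_rfl, dist_nonneg⟩ = x ∧ γ ⟨dist x y, dist_nonneg, le_rfl⟩ = y

/-- A metric space is geodesic if every pair of points is joined by a geodesic. -/
def IsGeodesicSpace (S : Type*) [MetricSpace S] : Prop :=
  ∀ x y : S, ∃ γ : Set.Icc (0 : ℝ) (dist x y) → S, IsGeodesic γ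

/-- A geodesic metric space is `δ`-hyperbolic if every side of every geodesic
triangle is contained in the closed `δ`-neighborhood of the union of the other
two sides. -/
def IsDeltaHyperbolic (S : Type*) [MetricSpace S] (δ : ℝ) : Prop :=
  ∀ (x y z : S)
    (γ₁ : Set.Icc (0 : ℝ) (dist x y) → S) (γ₂ : Set.Icc (0 : ℝ) (dist y z) → S)
    (γ₃ : Set.Icc (0 : ℝ) (dist x z) → S),
    IsGeodesic γ₁ → IsGeodesic γ₂ → IsGeodesic γ₃ →
      Set.range γ₁ ⊆ Metric.cthickening δ (Set.range γ₂ ∪ Set.range γ₃) ∧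
      Set.range γ₂ ⊆ Metric.cthickening δ (Set.range γ₁ ∪ Set.range γ₃) ∧
      Set.range γ₃ ⊆ Metric.cthickening δ (Set.range γ₁ ∪ Set.range γ₂)

/-- A subset `A` is `σ`-quasi-convex if every geodesic with endpoints in `A` stays
in the closed `σ`-neighborhood of `A`. -/
def IsQuasiConvex {S : Type*} [MetricSpace S] (σ : ℝ) (A : Set S) : Prop :=
  ∀ x y : S, x ∈ A → y ∈ A →
    ∀ γ : Set.Icc (0 : ℝ) (dist x y) → S, IsGeodesic γ →
      Set.range γ ⊆ Metric.cthickening σ A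

/-- `Φ` restricts to a unit speed geodesic on `[0, dist x y]` from `x` to `y`. -/
def IsGeodesicParam {S : Type*} [MetricSpace S] (x y : S) (Φ : ℝ → S) : Prop :=
  Φ 0 = x ∧ Φ (dist x y) = y ∧
    ∀ a ∈ Set.Icc 0 (dist x y), ∀ b ∈ Set.Icc 0 (dist x y), dist (Φ a) (Φ b) = |a - b|

/-- `w` lies on some geodesic from `x` to `y`. -/
def OnGeodesic {S : Type*} [MetricSpace S] (x y w : S) : Prop :=
  ∃ Φ, IsGeodesicParam x y Φ ∧ ∃ t ∈ Set.Icc 0 (dist x y), Φ t = w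

section Geodesics

variable {S : Type*} [MetricSpace S]

theorem IsGeodesicParam.isGeodesic {x y : S} {Φ : ℝ → S} (h : IsGeodesicParam x y Φ) :
    IsGeodesic (x := x) (y := y) (fun t => Φ t) :=
  ⟨Isometry.of_dist_eq fun a b => by
    rw [h.2.2 a a.2 b b.2, Subtype.dist_eq, Real.dist_eq], h.1, h.2.1⟩

theorem IsGeodesic.exists_param {x y : S} {γ : Set.Icc (0 : ℝ) (dist x y) → S}
    (h : IsGeodesic γ) : ∃ Φ, IsGeodesicParam x y Φ ∧ ∀ t : Set.Icc (0 : ℝ) (dist x y), Φ t = γ t := by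
  have e : ∀ t (ht : t ∈ Set.Icc 0 (dist x y)),
      Set.IccExtend dist_nonneg γ t = γ ⟨t, ht⟩ := fun t ht =>
    Set.IccExtend_of_mem _ _ ht
  refine ⟨Set.IccExtend dist_nonneg γ, ⟨?_, ?_, ?_⟩, fun t => e t t.2⟩
  · rw [e 0 ⟨le_rfl, dist_nonneg⟩]; exact h.2.1
  · rw [e _ ⟨dist_nonneg, le_rfl⟩]; exact h.2.2
  · intro a ha b hb
    rw [e a ha, e b hb, h.1.dist_eq, Subtype.dist_eq, Real.dist_eq]

theorem IsGeodesic.onGeodesic {x y w : S} {γ : Set.Icc (0 : ℝ) (dist x y) → S}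
    (h : IsGeodesic γ) (hw : w ∈ Set.range γ) : OnGeodesic x y w := by
  obtain ⟨Φ, hΦ, e⟩ := h.exists_param
  obtain ⟨t, rfl⟩ := hw
  exact ⟨Φ, hΦ, t, t.2, e t⟩

theorem OnGeodesic.dist_add_dist {x y w : S} (h : OnGeodesic x y w) :
    dist x w + dist w y = dist x y := by
  obtain ⟨Φ, ⟨h0, h1, hd⟩, t, ht, rfl⟩ := h
  have e0 := hd 0 ⟨le_rfl, dist_nonneg⟩ t ht
  have e1 := hd t ht _ ⟨dist_nonneg, le_rfl⟩
  rw [h0, zero_sub, abs_neg, abs_of_nonneg ht.1] at e0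
  rw [h1, abs_sub_comm, abs_of_nonneg (sub_nonneg.2 ht.2)] at e1
  linarith

theorem OnGeodesic.symm {x y w : S} (h : OnGeodesic x y w) : OnGeodesic y x w := by
  obtain ⟨Φ, ⟨h0, h1, hd⟩, t, ht, rfl⟩ := h
  have hmem : ∀ a ∈ Set.Icc 0 (dist x y), dist x y - a ∈ Set.Icc 0 (dist x y) :=
    fun a ha => ⟨by linarith [ha.2], by linarith [ha.1]⟩
  refine ⟨fun a => Φ (dist x y - a), ⟨by simpa using h1, ?_, ?_⟩, dist x y - t, ?_, ?_⟩
  · simpa [dist_comm y x] using h0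
  · rw [dist_comm y x]
    intro a ha b hb
    rw [hd _ (hmem a ha) _ (hmem b hb), abs_sub_comm]
    congr 1
    ring
  · rw [dist_comm y x]
    exact hmem t ht
  · simp

/-- A point between two points of a geodesic lies on a geodesic joining them. -/
theorem IsGeodesicParam.onGeodesic {x y : S} {Φ : ℝ → S} (h : IsGeodesicParam x y Φ)
    {a t b : ℝ} (ha : 0 ≤ a) (hat : a ≤ t) (htb : t ≤ b) (hb : b ≤ dist x y) :
    OnGeodesic (Φ a) (Φ b) (Φ t) := by
  have e : dist (Φ a) (Φ b) = b - a := by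
    rw [h.2.2 a ⟨ha, by linarith⟩ b ⟨by linarith, hb⟩, abs_sub_comm, abs_of_nonneg (by linarith)]
  refine ⟨fun u => Φ (a + u), ⟨by simp, by simp [e], ?_⟩, t - a, ?_, by simp⟩
  · rw [e]
    intro u hu v hv
    rw [h.2.2 _ ⟨by linarith [hu.1], by linarith [hu.2]⟩ _
      ⟨by linarith [hv.1], by linarith [hv.2]⟩]
    congr 1
    ring
  · rw [e]
    exact ⟨by linarith, by linarith⟩

theorem IsGeodesicParam.continuousOn {x y : S} {Φ : ℝ → S} (h : IsGeodesicParam x y Φ) :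
    ContinuousOn Φ (Set.Icc 0 (dist x y)) :=
  (LipschitzOnWith.of_dist_le_mul (K := 1) fun a ha b hb => by
    rw [h.2.2 a ha b hb, Real.dist_eq, NNReal.coe_one, one_mul]).continuousOn

theorem exists_dist_le_of_mem_cthickening {σ : ℝ} (hσ : 0 ≤ σ) {A : Set S} {w : S}
    (h : w ∈ Metric.cthickening σ A) : ∃ v ∈ A, dist w v ≤ σ + 1 := by
  have h' := Metric.cthickening_subset_thickening' (by linarith : 0 < σ + 1) (by linarith) A h
  obtain ⟨v, hv, hd⟩ := Metric.mem_thickening_iff.1 h'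
  exact ⟨v, hv, hd.le⟩

theorem IsDeltaHyperbolic.exists_onGeodesic {δ : ℝ} (hδ : 0 ≤ δ) (hgeo : IsGeodesicSpace S)
    (hhyp : IsDeltaHyperbolic S δ) {x y w : S} (z : S) (h : OnGeodesic x y w) :
    ∃ v, dist w v ≤ δ + 1 ∧ (OnGeodesic x z v ∨ OnGeodesic z y v) := by
  obtain ⟨Φ, hΦ, t, ht, rfl⟩ := h
  obtain ⟨γ₁, h₁⟩ := hgeo x z
  obtain ⟨γ₂, h₂⟩ := hgeo z y
  obtain ⟨v, hv, hd⟩ := exists_dist_le_of_mem_cthickening hδ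
    ((hhyp x z y γ₁ γ₂ _ h₁ h₂ hΦ.isGeodesic).2.2 ⟨⟨t, ht⟩, rfl⟩)
  exact ⟨v, hd, hv.imp h₁.onGeodesic h₂.onGeodesic⟩

/-- A geodesic joining the ends of a chain of at most `2 ^ N` steps stays within a distance
of the chain that is linear in `N`. -/
theorem IsDeltaHyperbolic.exists_dist_chain_le {δ : ℝ} (hδ : 0 ≤ δ) (hgeo : IsGeodesicSpace S)
    (hhyp : IsDeltaHyperbolic S δ) {P : ℕ → S} {M : ℝ} (hM : 0 ≤ M)
    (hP : ∀ i, dist (P i) (P (i + 1)) ≤ M) (N : ℕ) :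
    ∀ i j w, i ≤ j → j ≤ i + 2 ^ N → OnGeodesic (P i) (P j) w →
      ∃ k, k ≤ j ∧ dist w (P k) ≤ (δ + 1) * N + M := by
  induction N with
  | zero =>
    intro i j w hij hj hw
    refine ⟨i, hij, ?_⟩
    have h1 := hw.dist_add_dist
    have h2 : dist (P i) (P j) ≤ M := by
      obtain rfl | rfl : j = i ∨ j = i + 1 := by
        rw [pow_zero] at hj
        omega
      · simpa using hM
      · exact hP i
    rw [dist_comm]
    simp only [Nat.cast_zero, mul_zero, zero_add]
    linarith [dist_nonneg (x := w) (y := P j)]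
  | succ N ih =>
    intro i j w hij hj hw
    rw [pow_succ] at hj
    obtain ⟨v, hd, hv⟩ := hhyp.exists_onGeodesic hδ hgeo (P (min j (i + 2 ^ N))) hw
    have key : ∃ k, k ≤ j ∧ dist v (P k) ≤ (δ + 1) * N + M := by
      rcases hv with hv | hv
      · obtain ⟨k, hk, h⟩ := ih i _ v (by omega) (by omega) hv
        exact ⟨k, by omega, h⟩
      · exact ih _ j v (by omega) (by omega) hv
    obtain ⟨k, hk, h⟩ := key
    refine ⟨k, hk, ?_⟩
    push_cast
    linarith [dist_triangle w v (P k)]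

end Geodesics

theorem exists_nat_forall_linear_le_two_pow (a b : ℝ) :
    ∃ N₀ : ℕ, ∀ N ≥ N₀, a * N + b ≤ 2 ^ N := by
  have h1 := tendsto_pow_const_div_const_pow_of_one_lt 1 (one_lt_two (α := ℝ))
  have h0 := tendsto_pow_const_div_const_pow_of_one_lt 0 (one_lt_two (α := ℝ))
  have h := (h1.const_mul a).add (h0.const_mul b)
  simp only [mul_zero, add_zero] at h
  obtain ⟨N₀, hN₀⟩ := Filter.eventually_atTop.1 (h.eventually (gt_mem_nhds one_pos))
  refine ⟨N₀, fun N hN => ?_⟩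
  have h2 := hN₀ N hN
  have h3 : (0 : ℝ) < 2 ^ N := by positivity
  rw [pow_one, pow_zero, mul_div_assoc', mul_div_assoc', ← add_div, div_lt_one h3] at h2
  linarith

/-- A quantity that grows at most logarithmically in itself is bounded. -/
theorem exists_bound_of_le_log {A B C E : ℝ} (hA : 0 ≤ A) (hC : 0 < C) :
    ∃ K : ℝ, ∀ D : ℝ, (∀ N : ℕ, A * D + B ≤ 2 ^ N → D ≤ C * N + E) → D ≤ K := by
  obtain ⟨N₀, hN₀⟩ := exists_nat_forall_linear_le_two_pow (A * C) (A * (C + E) + B)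
  refine ⟨C * N₀ + E, fun D hD => ?_⟩
  by_contra! hlt
  have key : ∀ n : ℕ, C * (N₀ + n : ℕ) + E < D := by
    intro n
    induction n with
    | zero => simpa using hlt
    | succ n ih =>
      by_contra! hle
      have h1 := hN₀ (N₀ + n) (by omega)
      have h2 : A * D ≤ A * (C * (N₀ + (n + 1) : ℕ) + E) := mul_le_mul_of_nonneg_left hle hA
      have h3 := hD (N₀ + n) (by push_cast at h1 h2 ⊢; linarith)
      linarith
  obtain ⟨n, hn⟩ := exists_nat_gt ((D - E) / C)
  have h1 := key n
  rw [div_lt_iff₀ hC] at hn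
  have h2 : 0 ≤ C * (N₀ : ℝ) := by positivity
  push_cast at h1
  linarith

/-- Stability of quasi-geodesics: geodesics stay uniformly close to discrete
quasi-geodesics with the same ends. -/
theorem IsDeltaHyperbolic.exists_dist_quasiGeodesic_le {S : Type*} [MetricSpace S] {δ : ℝ}
    (hδ : 0 ≤ δ) (hgeo : IsGeodesicSpace S) (hhyp : IsDeltaHyperbolic S δ)
    {M μ c : ℝ} (hM : 0 ≤ M) (hμ : 0 ≤ μ) :
    ∃ K : ℝ, ∀ (P : ℕ → S) (n : ℕ), (∀ i, dist (P i) (P (i + 1)) ≤ M) →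
      (∀ i j, i ≤ j → j ≤ n → (j : ℝ) - i ≤ μ * dist (P i) (P j) + c) →
      ∀ w, OnGeodesic (P 0) (P n) w → ∃ k ≤ n, dist w (P k) ≤ K := by
  obtain ⟨K, hK⟩ := exists_bound_of_le_log (A := 6 * μ) (B := c) (C := δ + 1)
    (E := 2 * (δ + 1) + M) (by positivity) (by positivity)
  refine ⟨K, fun P n hP hqi w hw => ?_⟩
  obtain ⟨Φ, hΦ, u, hu, rfl⟩ := hw
  set d := dist (P 0) (P n)
  set A : Set S := P '' Set.Iic n
  have hA : IsCompact A := ((Set.finite_Iic n).image P).isCompact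
  have hAne : A.Nonempty := ⟨P 0, 0, Nat.zero_le n, rfl⟩
  have hnear : ∀ p, ∃ k ≤ n, dist p (P k) = Metric.infDist p A := fun p => by
    obtain ⟨_, ⟨k, hk, rfl⟩, h⟩ := hA.exists_infDist_eq_dist hAne p
    exact ⟨k, hk, h.symm⟩
  have hle : ∀ p, ∀ k ≤ n, Metric.infDist p A ≤ dist p (P k) := fun p k hk =>
    Metric.infDist_le_dist_of_mem ⟨k, hk, rfl⟩
  obtain ⟨t, ht, hmax⟩ := isCompact_Icc.exists_isMaxOn ⟨u, hu⟩
    ((Metric.continuous_infDist_pt A).comp_continuousOn hΦ.continuousOn)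
  set D := Metric.infDist (Φ t) A
  have hD0 : 0 ≤ D := Metric.infDist_nonneg
  have hmaxD : ∀ v ∈ Set.Icc 0 d, Metric.infDist (Φ v) A ≤ D := fun v hv => hmax hv
  suffices hDK : D ≤ K by
    obtain ⟨k, hk, h⟩ := hnear (Φ u)
    exact ⟨k, hk, h.trans_le ((hmaxD u hu).trans hDK)⟩
  have hfar : ∀ r ∈ Set.Icc 0 d, |t - r| = 2 * D → ∀ k, dist (Φ r) (P k) ≤ D →
      ∀ v, dist (Φ t) v ≤ 2 * (δ + 1) → OnGeodesic (Φ r) (P k) v → D ≤ 2 * (δ + 1) := by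
    intro r hr hrt k hk v hv hg
    have h1 := hg.dist_add_dist
    have h2 := hΦ.2.2 t ht r hr
    have h3 := dist_triangle (Φ t) v (Φ r)
    rw [dist_comm v] at h3
    linarith [dist_nonneg (x := v) (y := P k)]
  have hend : ∀ k ≤ n, ∀ v, dist (Φ t) v ≤ 2 * (δ + 1) → OnGeodesic (P k) (P k) v →
      D ≤ 2 * (δ + 1) := by
    intro k hk v hv hg
    have h1 := hg.dist_add_dist
    rw [dist_self] at h1
    have h2 : P k = v := dist_le_zero.1 (by linarith [dist_nonneg (x := v) (y := P k)])
    exact (hle _ k hk).trans (h2 ▸ hv)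
  have hleft : ∃ a, 0 ≤ a ∧ a ≤ t ∧ t - a ≤ 2 * D ∧ ∃ i ≤ n, dist (Φ a) (P i) ≤ D ∧
      ∀ v, dist (Φ t) v ≤ 2 * (δ + 1) → OnGeodesic (Φ a) (P i) v → D ≤ 2 * (δ + 1) := by
    rcases le_total t (2 * D) with h | h
    · refine ⟨0, le_rfl, ht.1, by linarith, 0, Nat.zero_le n, ?_, ?_⟩
      · rw [hΦ.1, dist_self]
        exact hD0
      · rw [hΦ.1]
        exact hend 0 (Nat.zero_le n)
    · have hr : t - 2 * D ∈ Set.Icc 0 d := ⟨by linarith, by linarith [ht.2]⟩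
      obtain ⟨i, hi, hdi⟩ := hnear (Φ (t - 2 * D))
      have hi' := hdi.trans_le (hmaxD _ hr)
      exact ⟨t - 2 * D, hr.1, by linarith, by linarith, i, hi, hi',
        hfar _ hr (by rw [sub_sub_cancel, abs_of_nonneg (by linarith)]) i hi'⟩
  have hright : ∃ b, t ≤ b ∧ b ≤ d ∧ b - t ≤ 2 * D ∧ ∃ j ≤ n, dist (Φ b) (P j) ≤ D ∧
      ∀ v, dist (Φ t) v ≤ 2 * (δ + 1) → OnGeodesic (Φ b) (P j) v → D ≤ 2 * (δ + 1) := by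
    rcases le_total d (t + 2 * D) with h | h
    · refine ⟨d, ht.2, le_rfl, by linarith, n, le_rfl, ?_, ?_⟩
      · rw [hΦ.2.1, dist_self]
        exact hD0
      · rw [hΦ.2.1]
        exact hend n le_rfl
    · have hr : t + 2 * D ∈ Set.Icc 0 d := ⟨by linarith [ht.1], h⟩
      obtain ⟨j, hj, hdj⟩ := hnear (Φ (t + 2 * D))
      have hj' := hdj.trans_le (hmaxD _ hr)
      exact ⟨t + 2 * D, by linarith, hr.2, by linarith, j, hj, hj',
        hfar _ hr (by rw [sub_add_cancel_left, abs_neg, abs_of_nonneg (by linarith)]) j hj'⟩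
  obtain ⟨a, ha0, hat, hta, i, hi, hdi, hfi⟩ := hleft
  obtain ⟨b, htb, hbd, hbt, j, hj, hdj, hfj⟩ := hright
  refine hK D fun N hN => ?_
  have hN0 : 0 ≤ (δ + 1) * N := by positivity
  have hab := hΦ.2.2 a ⟨ha0, by linarith⟩ b ⟨by linarith, hbd⟩
  rw [abs_sub_comm, abs_of_nonneg (by linarith)] at hab
  have hij : dist (P i) (P j) ≤ 6 * D := by
    have := dist_triangle4 (P i) (Φ a) (Φ b) (P j)
    rw [dist_comm (P i) (Φ a)] at this
    linarith
  have hμij := mul_le_mul_of_nonneg_left hij hμ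
  obtain ⟨v, hv, hv'⟩ := hhyp.exists_onGeodesic hδ hgeo (P i) (hΦ.onGeodesic ha0 hat htb hbd)
  rcases hv' with hv' | hv'
  · linarith [hfi v (by linarith) hv']
  obtain ⟨z, hz, hz'⟩ := hhyp.exists_onGeodesic hδ hgeo (P j) hv'
  have htz : dist (Φ t) z ≤ 2 * (δ + 1) := by linarith [dist_triangle (Φ t) v z]
  rcases hz' with hz' | hz'
  · have key : ∃ k ≤ n, dist z (P k) ≤ (δ + 1) * N + M := by
      rcases le_total i j with h | h
      · have h1 : j ≤ i + 2 ^ N := by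
          have := hqi i j h hj
          have h2 : (j : ℝ) ≤ i + 2 ^ N := by linarith
          exact_mod_cast h2
        obtain ⟨k, hk, h⟩ := hhyp.exists_dist_chain_le hδ hgeo hM hP N i j z h h1 hz'
        exact ⟨k, hk.trans hj, h⟩
      · have h1 : i ≤ j + 2 ^ N := by
          have := hqi j i h hi
          rw [dist_comm] at this
          have h2 : (i : ℝ) ≤ j + 2 ^ N := by linarith
          exact_mod_cast h2
        obtain ⟨k, hk, h⟩ := hhyp.exists_dist_chain_le hδ hgeo hM hP N j i z h h1 hz'.symm
        exact ⟨k, hk.trans hi, h⟩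
    obtain ⟨k, hk, h⟩ := key
    linarith [hle (Φ t) k hk, dist_triangle (Φ t) z (P k)]
  · linarith [hfj z htz hz'.symm]

section Action

variable {G S : Type*} [Group G] [MetricSpace S] [MulAction G S]

theorem dist_smul_eq_dist_inv_mul (hiso : ∀ g : G, Isometry (fun p : S => g • p)) (s : S)
    (g h : G) : dist (g • s) (h • s) = dist s ((g⁻¹ * h) • s) := by
  have := (hiso g).dist_eq s ((g⁻¹ * h) • s)
  simpa [smul_smul] using this

theorem exists_word_length_bound_of_quasiConvex
    (hiso : ∀ g : G, Isometry (fun p : S => g • p)) (hgeo : IsGeodesicSpace S)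
    {s : S} {Q : Subgroup G} {σ : ℝ} (hσ : 0 ≤ σ)
    (hqc : IsQuasiConvex σ ((fun q : G => q • s) '' (Q : Set G)))
    (hproper : ∀ B : Set S, Bornology.IsBounded B →
      {q : G | q ∈ Q ∧ ((fun p : S => q • p) '' B ∩ B).Nonempty}.Finite) :
    ∃ Y : Finset G, (Y : Set G) ⊆ (Q : Set G) ∧ ∀ g ∈ Q, ∃ L : List G,
      (∀ y ∈ L, y ∈ Y) ∧ L.prod = g ∧ (L.length : ℝ) ≤ dist s (g • s) + 2 := by
  set R := 2 * (σ + 1) + 1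
  have hfin : {q : G | q ∈ Q ∧ dist s (q • s) ≤ R}.Finite := by
    refine (hproper (Metric.closedBall s R) Metric.isBounded_closedBall).subset ?_
    rintro q ⟨hq, hd⟩
    refine ⟨hq, q • s, ⟨s, Metric.mem_closedBall_self (by positivity), rfl⟩, ?_⟩
    rwa [Metric.mem_closedBall, dist_comm]
  refine ⟨hfin.toFinset, fun q hq => (hfin.mem_toFinset.1 hq).1, fun g hg => ?_⟩
  obtain ⟨γ, hγ⟩ := hgeo s (g • s)
  have hclose : ∀ w ∈ Set.range γ, ∃ q ∈ Q, dist w (q • s) ≤ σ + 1 := fun w hw => by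
    obtain ⟨_, ⟨q, hq, rfl⟩, h⟩ := exists_dist_le_of_mem_cthickening hσ
      (hqc s (g • s) ⟨1, Q.one_mem, one_smul G s⟩ ⟨g, hg, rfl⟩ γ hγ hw)
    exact ⟨q, hq, h⟩
  obtain ⟨Φ, hΦ, e⟩ := hγ.exists_param
  have key : ∀ n : ℕ, ∀ t ∈ Set.Icc 0 (dist s (g • s)), t ≤ n → ∀ q ∈ Q,
      dist (Φ t) (q • s) ≤ σ + 1 →
      ∃ L : List G, (∀ y ∈ L, y ∈ hfin.toFinset) ∧ L.prod = q ∧ L.length ≤ n + 1 := by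
    intro n
    induction n with
    | zero =>
      intro t ht htn q hq hd
      obtain rfl : t = 0 := le_antisymm (by simpa using htn) ht.1
      rw [hΦ.1] at hd
      refine ⟨[q], ?_, by simp, by simp⟩
      simp only [List.mem_singleton, forall_eq, hfin.mem_toFinset]
      exact ⟨hq, by linarith⟩
    | succ n ih =>
      intro t ht htn q hq hd
      have hr : max (t - 1) 0 ∈ Set.Icc 0 (dist s (g • s)) :=
        ⟨le_max_right _ _, max_le (by linarith [ht.2]) dist_nonneg⟩
      obtain ⟨q', hq', hd'⟩ := hclose (Φ (max (t - 1) 0)) ⟨⟨_, hr⟩, (e ⟨_, hr⟩).symm⟩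
      push_cast at htn
      obtain ⟨L, hL, hprod, hlen⟩ :=
        ih _ hr (max_le (by linarith) (Nat.cast_nonneg n)) q' hq' hd'
      refine ⟨L ++ [q'⁻¹ * q], ?_, by simp [hprod], by simpa using hlen⟩
      intro y hy
      rcases List.mem_append.1 hy with hy | hy
      · exact hL y hy
      · obtain rfl := List.mem_singleton.1 hy
        refine hfin.mem_toFinset.2 ⟨Q.mul_mem (Q.inv_mem hq') hq, ?_⟩
        rw [← dist_smul_eq_dist_inv_mul hiso]
        have h1 := dist_triangle4 (q' • s) (Φ (max (t - 1) 0)) (Φ t) (q • s)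
        rw [dist_comm (q' • s) (Φ _), hΦ.2.2 _ hr t ht] at h1
        have h2 : |max (t - 1) 0 - t| ≤ 1 := by
          rw [abs_le]
          have h3 : max (t - 1) 0 ≤ t := max_le (by linarith) ht.1
          exact ⟨by linarith [le_max_left (t - 1) 0], by linarith⟩
        linarith
  obtain ⟨L, hL, hprod, hlen⟩ := key ⌈dist s (g • s)⌉₊ _ ⟨dist_nonneg, le_rfl⟩ (Nat.le_ceil _)
    g hg (by rw [hΦ.2.1, dist_self]; positivity)
  refine ⟨L, hL, hprod, ?_⟩
  have h1 : (L.length : ℝ) ≤ ⌈dist s (g • s)⌉₊ + 1 := by exact_mod_cast hlen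
  linarith [Nat.ceil_lt_add_one (dist_nonneg (x := s) (y := g • s))]

theorem finite_of_word_length_bound (hiso : ∀ g : G, Isometry (fun p : S => g • p))
    {s : S} {Q : Subgroup G} {Z : Set G} (hZ : Z.Finite) {μ c : ℝ} (hμ : 0 ≤ μ)
    (hword : ∀ g ∈ Q, ∃ L : List G,
      (∀ y ∈ L, y ∈ Z) ∧ L.prod = g ∧ (L.length : ℝ) ≤ μ * dist s (g • s) + c)
    {B : Set S} (hB : Bornology.IsBounded B) :
    {q : G | q ∈ Q ∧ ((fun p : S => q • p) '' B ∩ B).Nonempty}.Finite := by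
  obtain ⟨R, hR⟩ := hB.subset_closedBall s
  have hfin : ({L : List G | L.length ≤ ⌊μ * (2 * R) + c⌋₊ ∧ ∀ y ∈ L, y ∈ Z}).Finite := by
    have := hZ.to_subtype
    refine ((List.finite_length_le Z ⌊μ * (2 * R) + c⌋₊).image
      (List.map Subtype.val)).subset ?_
    rintro L ⟨hL, hy⟩
    lift L to List Z using hy
    exact ⟨L, by simpa using hL, rfl⟩
  refine (hfin.image List.prod).subset ?_
  rintro q ⟨hq, _, ⟨p, hp, rfl⟩, hqp⟩
  obtain ⟨L, hL, hprod, hlen⟩ := hword q hq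
  refine ⟨L, ⟨Nat.le_floor (hlen.trans ?_), hL⟩, hprod⟩
  have h1 : dist s (q • s) ≤ 2 * R := by
    have h2 := hR hp
    have h3 := hR hqp
    rw [Metric.mem_closedBall] at h2 h3
    have h4 : dist (q • p) (q • s) = dist p s := (hiso q).dist_eq p s
    have h5 := dist_triangle s (q • p) (q • s)
    rw [dist_comm s (q • p)] at h5
    linarith
  linarith [mul_le_mul_of_nonneg_left h1 hμ]

theorem exists_isQuasiConvex_of_word_length_bound
    (hiso : ∀ g : G, Isometry (fun p : S => g • p))
    {δ : ℝ} (hδ : 0 ≤ δ) (hgeo : IsGeodesicSpace S) (hhyp : IsDeltaHyperbolic S δ)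
    {s : S} {Q : Subgroup G} {Z : Set G} (hZ : Z.Finite) (hZQ : Z ⊆ Q)
    {μ c : ℝ} (hμ : 0 ≤ μ)
    (hword : ∀ g ∈ Q, ∃ L : List G,
      (∀ y ∈ L, y ∈ Z) ∧ L.prod = g ∧ (L.length : ℝ) ≤ μ * dist s (g • s) + c) :
    ∃ σ : ℝ, 0 ≤ σ ∧ IsQuasiConvex σ ((fun q : G => q • s) '' (Q : Set G)) := by
  obtain ⟨M, hM⟩ := (hZ.image fun y => dist s (y • s)).bddAbove
  obtain ⟨K, hK⟩ := hhyp.exists_dist_quasiGeodesic_le hδ hgeo (M := max M 0) (c := c)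
    (le_max_right _ _) hμ
  refine ⟨max K 0, le_max_right _ _, ?_⟩
  rintro _ _ ⟨q, hq, rfl⟩ ⟨q', hq', rfl⟩ γ hγ w hw
  have hex : ∃ n, ∃ L : List G, (∀ y ∈ L, y ∈ Z) ∧ L.prod = q⁻¹ * q' ∧ L.length = n := by
    obtain ⟨L, hL, hprod, -⟩ := hword _ (Q.mul_mem (Q.inv_mem hq) hq')
    exact ⟨_, L, hL, hprod, rfl⟩
  classical
  obtain ⟨L, hL, hprod, hlen⟩ := Nat.find_spec hex
  have hmin : ∀ L' : List G, (∀ y ∈ L', y ∈ Z) → L'.prod = q⁻¹ * q' →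
      L.length ≤ L'.length := fun L' h1 h2 =>
    hlen.trans_le (Nat.find_min' hex ⟨L', h1, h2, rfl⟩)
  have hprodQ : ∀ L' : List G, (∀ y ∈ L', y ∈ Z) → L'.prod ∈ Q := fun L' h =>
    Q.list_prod_mem fun y hy => hZQ (h y hy)
  have htake : ∀ i, ∀ y ∈ L.take i, y ∈ Z := fun i y hy => hL y (List.mem_of_mem_take hy)
  have hdrop : ∀ i, ∀ y ∈ L.drop i, y ∈ Z := fun i y hy => hL y (List.mem_of_mem_drop hy)
  have hPdist : ∀ g h : G, dist ((q * g) • s) ((q * h) • s) = dist s ((g⁻¹ * h) • s) := by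
    intro g h
    rw [dist_smul_eq_dist_inv_mul hiso, mul_inv_rev, mul_assoc, inv_mul_cancel_left]
  suffices h : ∃ k ≤ L.length, dist w ((q * (L.take k).prod) • s) ≤ K by
    obtain ⟨k, -, hk⟩ := h
    exact Metric.mem_cthickening_of_dist_le w _ _ _
      ⟨q * (L.take k).prod, Q.mul_mem hq (hprodQ _ (htake k)), rfl⟩ (hk.trans (le_max_left _ _))
  refine hK (fun i => (q * (L.take i).prod) • s) L.length ?_ ?_ w ?_
  · intro i
    rw [hPdist]
    rcases lt_or_ge i L.length with hi | hi
    · rw [List.prod_take_succ _ _ hi, inv_mul_cancel_left]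
      exact (hM ⟨_, hL _ (List.getElem_mem hi), rfl⟩).trans (le_max_left _ _)
    · rw [List.take_of_length_le hi, List.take_of_length_le (by omega), inv_mul_cancel, one_smul,
        dist_self]
      exact le_max_right _ _
  · intro i j hij hj
    rw [hPdist]
    obtain ⟨L', hL', hprod', hlen'⟩ := hword ((L.take i).prod⁻¹ * (L.take j).prod)
      (Q.mul_mem (Q.inv_mem (hprodQ _ (htake i))) (hprodQ _ (htake j)))
    have h1 := hmin (L.take i ++ L' ++ L.drop j) ?_ ?_
    · simp only [List.length_append, List.length_take, List.length_drop] at h1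
      have h2 : j ≤ i + L'.length := by omega
      have h3 : (j : ℝ) ≤ i + L'.length := by exact_mod_cast h2
      linarith
    · intro y hy
      simp only [List.mem_append] at hy
      rcases hy with (hy | hy) | hy
      · exact htake i y hy
      · exact hL' y hy
      · exact hdrop j y hy
    · rw [List.prod_append, List.prod_append, hprod', mul_inv_cancel_left,
        List.prod_take_mul_prod_drop, hprod]
  · have h := hγ.onGeodesic hw
    simpa [hprod] using h

end Action

/-- Lemma 2.6 ("lem:proper"): for a group `G` acting by isometries on a
`δ`-hyperbolic geodesic space `S`, a subgroup `Q` has quasi-convex orbit `Q • s`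
and acts metrically properly on `S` if and only if `Q` is generated by a finite
set `Y` with the word length of each `g ∈ Q` over `Y ∪ Y⁻¹` bounded by
`μ * dist s (g • s) + c` for some constants `μ ≥ 1`, `c ≥ 0`. -/
theorem orbit_quasiconvex_and_proper_iff_word_length_bound
    {G S : Type*} [Group G] [MetricSpace S] [MulAction G S]
    (hiso : ∀ g : G, Isometry (fun p : S => g • p))
    (δ : ℝ) (hδ : 0 ≤ δ) (hgeo : IsGeodesicSpace S) (hhyp : IsDeltaHyperbolic S δ)
    (s : S) (Q : Subgroup G) :
    ((∃ σ : ℝ, 0 ≤ σ ∧ IsQuasiConvex σ ((fun q : G => q • s) '' (Q : Set G))) ∧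
      (∀ B : Set S, Bornology.IsBounded B →
        {q : G | q ∈ Q ∧ ((fun p : S => q • p) '' B ∩ B).Nonempty}.Finite))
    ↔
    (∃ Y : Finset G, (Y : Set G) ⊆ (Q : Set G) ∧ Subgroup.closure (Y : Set G) = Q ∧
      ∃ μ c : ℝ, 1 ≤ μ ∧ 0 ≤ c ∧
        ∀ g ∈ Q, ∃ L : List G,
          (∀ y ∈ L, y ∈ (Y : Set G) ∪ ((Y : Set G))⁻¹) ∧ L.prod = g ∧
          (L.length : ℝ) ≤ μ * dist s (g • s) + c) := by
  constructor
  · rintro ⟨⟨σ, hσ, hqc⟩, hproper⟩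
    obtain ⟨Y, hYQ, hword⟩ := exists_word_length_bound_of_quasiConvex hiso hgeo hσ hqc hproper
    refine ⟨Y, hYQ, le_antisymm ((Subgroup.closure_le Q).2 hYQ) fun g hg => ?_, 1, 2, le_rfl,
      zero_le_two, fun g hg => ?_⟩
    · obtain ⟨L, hL, rfl, -⟩ := hword g hg
      exact Subgroup.list_prod_mem _ fun y hy => Subgroup.subset_closure (hL y hy)
    · obtain ⟨L, hL, hprod, hlen⟩ := hword g hg
      exact ⟨L, fun y hy => Or.inl (hL y hy), hprod, by rwa [one_mul]⟩
  · rintro ⟨Y, hYQ, -, μ, c, hμ, -, hword⟩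
    have hZ : ((Y : Set G) ∪ (Y : Set G)⁻¹).Finite := Y.finite_toSet.union Y.finite_toSet.inv
    have hZQ : (Y : Set G) ∪ (Y : Set G)⁻¹ ⊆ Q :=
      Set.union_subset hYQ fun y hy => Q.inv_mem_iff.1 (hYQ hy)
    have hμ0 : 0 ≤ μ := zero_le_one.trans hμ
    exact ⟨exists_isQuasiConvex_of_word_length_bound hiso hδ hgeo hhyp hZ hZQ hμ0 hword,
      fun B hB => finite_of_word_length_bound hiso hZ hμ0 hword hB⟩
end

section
/- Let H be a free abelian group (an additive commutative group that is a free ℤ-module), and let φ : H →+ H be an additive endomorphism such that for every h ∈ H there exist nonzero integers m and n with m • φ(h) = n • h. Then there exists a nonzero integer s such that φ(h) = s • h for all h ∈ H. -/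
/-- A commensurating additive endomorphism of a free abelian group is
multiplication by a fixed nonzero integer. -/
theorem commensurating_endomorphism_of_free_abelian
    {H : Type*} [AddCommGroup H] [Module.Free ℤ H]
    (φ : H →+ H)
    (hφ : ∀ h : H, ∃ m n : ℤ, m ≠ 0 ∧ n ≠ 0 ∧ m • φ h = n • h) :
    ∃ s : ℤ, s ≠ 0 ∧ ∀ h : H, φ h = s • h := by
  classical
  let b := Module.Free.chooseBasis ℤ H
  have coord : ∀ h, ∃ m n : ℤ, m ≠ 0 ∧ n ≠ 0 ∧
      ∀ k, m * b.repr (φ h) k = n * b.repr h k := by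
    intro h
    obtain ⟨m, n, hm, hn, e⟩ := hφ h
    refine ⟨m, n, hm, hn, fun k => ?_⟩
    simpa using congrArg (fun x => b.repr x k) e
  have off_diag : ∀ i j, i ≠ j → b.repr (φ (b i)) j = 0 := by
    intro i j hij
    obtain ⟨m, n, hm, -, e⟩ := coord (b i)
    simpa [Finsupp.single_apply, hij, hm] using e j
  have diag_ne_zero : ∀ i, b.repr (φ (b i)) i ≠ 0 := by
    intro i hi
    obtain ⟨m, n, -, hn, e⟩ := coord (b i)
    have := e i
    simp [hi] at this
    exact hn this.symm
  have diag_eq : ∀ i j, b.repr (φ (b i)) i = b.repr (φ (b j)) j := by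
    intro i j
    by_cases hij : i = j
    · rw [hij]
    obtain ⟨m, n, hm, -, e⟩ := coord (b i + b j)
    have hi := e i
    have hj := e j
    simp [hij, Ne.symm hij, off_diag i j hij,
      off_diag j i (Ne.symm hij)] at hi hj
    exact mul_left_cancel₀ hm (hi.trans hj.symm)
  rcases isEmpty_or_nonempty (Module.Free.ChooseBasisIndex ℤ H) with hI | ⟨⟨i₀⟩⟩
  · exact ⟨1, one_ne_zero, fun h => b.repr.injective (Subsingleton.elim _ _)⟩
  refine ⟨b.repr (φ (b i₀)) i₀, diag_ne_zero i₀, fun h => ?_⟩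
  have key : φ.toIntLinearMap = b.repr (φ (b i₀)) i₀ • LinearMap.id := by
    refine b.ext fun i => b.repr.injective (Finsupp.ext fun j => ?_)
    by_cases hij : i = j
    · subst hij
      simp [diag_eq i i₀]
    · simp [hij, off_diag i j hij]
  exact LinearMap.congr_fun key h
end

section
/- Let F be the free group on two generators (FreeGroup (Fin 2)), let Q be a finite non-abelian simple group, and let G = F × Q. Then: (a) every normal subgroup N of G either contains the factor {1} × Q or is contained in the factor F × {1}; (b) consequently, the projection endomorphism φ : G →* G defined by φ(f, q) = (1, q) satisfies φ(N) ⊆ N for every normal subgroup N of G (i.e. φ is a normal endomorphism), and the range of φ is {1} × Q. -/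
theorem IsSimpleGroup.center_eq_bot {Q : Type*} [Group Q] [IsSimpleGroup Q]
    (hna : ¬ ∀ a b : Q, a * b = b * a) : Subgroup.center Q = ⊥ := by
  refine (Subgroup.Normal.eq_bot_or_eq_top inferInstance).resolve_right fun h => hna fun a b => ?_
  have hb : b ∈ Subgroup.center Q := h ▸ Subgroup.mem_top b
  exact Subgroup.mem_center_iff.mp hb a

/-- A normal subgroup of `H × Q`, with `Q` non-abelian simple, contains `1 × Q` or lies
in `H × 1`. -/
theorem Subgroup.Normal.range_inr_le_or_le_range_inl {H Q : Type*} [Group H] [Group Q]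
    [IsSimpleGroup Q] (hna : ¬ ∀ a b : Q, a * b = b * a) {N : Subgroup (H × Q)}
    (hN : N.Normal) :
    (MonoidHom.inr H Q).range ≤ N ∨ N ≤ (MonoidHom.inl H Q).range := by
  rcases (hN.comap (MonoidHom.inr H Q)).eq_bot_or_eq_top with h | h
  · right
    rintro ⟨f, q⟩ hfq
    have hq : q ∈ Subgroup.center Q := by
      refine Subgroup.mem_center_iff.mpr fun x => ?_
      have hc : x * q * x⁻¹ * q⁻¹ ∈ N.comap (MonoidHom.inr H Q) := by
        simpa using N.mul_mem (hN.conj_mem _ hfq (1, x)) (N.inv_mem hfq)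
      rw [h, Subgroup.mem_bot] at hc
      exact mul_inv_eq_iff_eq_mul.mp (mul_inv_eq_one.mp hc)
    rw [IsSimpleGroup.center_eq_bot hna, Subgroup.mem_bot] at hq
    exact ⟨f, by simp [hq]⟩
  · left
    rintro _ ⟨q, rfl⟩
    exact Subgroup.mem_comap.mp (h ▸ Subgroup.mem_top q)

/-- Let `G = F₂ × Q` with `F₂` free of rank 2 and `Q` a finite non-abelian simple
group. (a) Every normal subgroup of `G` contains `{1} × Q` or is contained in
`F₂ × {1}`. (b) Hence the projection `φ(f, q) = (1, q)` maps every normal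
subgroup into itself (it is a normal endomorphism), and its range is `{1} × Q`. -/
theorem free_times_simple_normal_endomorphism
    (Q : Type*) [Group Q] [Finite Q] [IsSimpleGroup Q]
    (hna : ¬ ∀ a b : Q, a * b = b * a) :
    (∀ N : Subgroup (FreeGroup (Fin 2) × Q), N.Normal →
      ((MonoidHom.inr (FreeGroup (Fin 2)) Q).range ≤ N ∨
        N ≤ (MonoidHom.inl (FreeGroup (Fin 2)) Q).range)) ∧
    (∀ N : Subgroup (FreeGroup (Fin 2) × Q), N.Normal →
      Subgroup.map ((MonoidHom.inr (FreeGroup (Fin 2)) Q).comp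
        (MonoidHom.snd (FreeGroup (Fin 2)) Q)) N ≤ N) ∧
    ((MonoidHom.inr (FreeGroup (Fin 2)) Q).comp
        (MonoidHom.snd (FreeGroup (Fin 2)) Q)).range
      = (MonoidHom.inr (FreeGroup (Fin 2)) Q).range := by
  refine ⟨fun N hN => hN.range_inr_le_or_le_range_inl hna, fun N hN => ?_, ?_⟩
  · rintro _ ⟨⟨f, q⟩, hfq, rfl⟩
    rcases hN.range_inr_le_or_le_range_inl hna with h | h
    · exact h ⟨q, rfl⟩
    · obtain ⟨g, hg⟩ := h hfq
      obtain ⟨rfl, rfl⟩ := Prod.mk.inj hg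
      exact N.one_mem
  · rw [MonoidHom.range_comp, MonoidHom.range_eq_top.mpr Prod.snd_surjective,
      ← MonoidHom.range_eq_map]
end

section
/- Let G be a finitely generated group and H a subgroup of finite index in G. Then the subgroup {α ∈ MulAut G : Subgroup.map α.toMonoidHom H = H} has finite index in MulAut G; consequently, its image in Out(G) has finite index in Out(G). -/
/-- The inner automorphisms form a normal subgroup of `MulAut G`. -/
instance conjRangeNormal (G : Type*) [Group G] :
    ((MulAut.conj : G →* MulAut G).range).Normal := by
  constructor
  intro x hx α
  obtain ⟨g, rfl⟩ := hx
  refine ⟨α g, ?_⟩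
  ext h
  simp [MulAut.conj_apply, MulAut.mul_apply]

/-- The outer automorphism group of `G`: the quotient of `MulAut G` by the
inner automorphisms. -/
abbrev OuterAut (G : Type*) [Group G] :=
  MulAut G ⧸ (MulAut.conj : G →* MulAut G).range

lemma mulAut_toMonoidHom_mul {G : Type*} [Group G] (a b : MulAut G) :
    (a * b).toMonoidHom = a.toMonoidHom.comp b.toMonoidHom := by
  ext x; rfl

/-- The subgroup of `MulAut G` consisting of automorphisms preserving the
subgroup `H`. -/
def autStab {G : Type*} [Group G] (H : Subgroup G) : Subgroup (MulAut G) where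
  carrier := {α : MulAut G | Subgroup.map α.toMonoidHom H = H}
  one_mem' := by
    ext x
    simp [Subgroup.mem_map]
  mul_mem' := by
    intro a b ha hb
    show Subgroup.map (a * b).toMonoidHom H = H
    rw [mulAut_toMonoidHom_mul, ← Subgroup.map_map]
    rw [show Subgroup.map b.toMonoidHom H = H from hb,
      show Subgroup.map a.toMonoidHom H = H from ha]
  inv_mem' := by
    intro a ha
    show Subgroup.map (a⁻¹ : MulAut G).toMonoidHom H = H
    conv_lhs => rw [← show Subgroup.map a.toMonoidHom H = H from ha]
    rw [Subgroup.map_map, ← mulAut_toMonoidHom_mul, inv_mul_cancel]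
    ext x
    simp [Subgroup.mem_map]

open scoped Pointwise in
lemma autStab_eq_stabilizer {G : Type*} [Group G] (H : Subgroup G) :
    autStab H = MulAction.stabilizer (MulAut G) H :=
  rfl

/-- There are finitely many homomorphisms from a finitely generated group to a finite group. -/
lemma finite_monoidHom_of_fg (G P : Type*) [Group G] [Group.FG G] [Group P] [Finite P] :
    Finite (G →* P) := by
  obtain ⟨S, hS, hfin⟩ := Group.fg_iff.mp ‹Group.FG G›
  have : Finite S := hfin
  refine Finite.of_injective (fun (f : G →* P) (s : S) => f (s : G)) fun f g hfg => ?_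
  exact MonoidHom.eq_of_eqOn_dense hS fun s hs => congrFun hfg ⟨s, hs⟩

/-- A finitely generated group has finitely many subgroups of any given nonzero index. -/
lemma finite_setOf_index_eq (G : Type*) [Group G] [Group.FG G] {n : ℕ} (hn : n ≠ 0) :
    {K : Subgroup G | K.index = n}.Finite := by
  have := finite_monoidHom_of_fg G (Equiv.Perm (Fin n))
  refine (Set.finite_range fun p : (G →* Equiv.Perm (Fin n)) × Fin n =>
    (MulAction.stabilizer (Equiv.Perm (Fin n)) p.2).comap p.1).subset fun K hK => ?_
  have hcard : Nat.card (G ⧸ K) = n := hK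
  have : Finite (G ⧸ K) := Nat.finite_of_card_ne_zero (hcard ▸ hn)
  let e : G ⧸ K ≃ Fin n := Finite.equivFinOfCardEq hcard
  refine ⟨(e.permCongrHom.toMonoidHom.comp (MulAction.toPermHom G (G ⧸ K)),
    e ((1 : G) : G ⧸ K)), ?_⟩
  ext g
  simp [Subgroup.mem_comap, MulAction.mem_stabilizer_iff, Equiv.permCongrHom,
    QuotientGroup.eq]

/-- If `G` is finitely generated and `H ≤ G` has finite index, then the
automorphisms of `G` preserving `H` form a finite-index subgroup of `MulAut G`,
and consequently their image in `Out(G)` has finite index. -/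
theorem autStab_finiteIndex_of_finiteIndex
    (G : Type*) [Group G] [Group.FG G] (H : Subgroup G) (hH : H.index ≠ 0) :
    (autStab H).index ≠ 0 ∧
    (Subgroup.map (QuotientGroup.mk' (MulAut.conj : G →* MulAut G).range)
      (autStab H)).index ≠ 0 := by
  have h : (autStab H).index ≠ 0 := by
    open scoped Pointwise in
    rw [autStab_eq_stabilizer, MulAction.index_stabilizer]
    refine (Set.ncard_pos ((finite_setOf_index_eq G hH).subset ?_)).mpr
      (MulAction.nonempty_orbit H) |>.ne'
    rintro _ ⟨α, rfl⟩
    exact Subgroup.index_map_equiv H α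
  exact ⟨h, ne_zero_of_dvd_ne_zero h <| (autStab H).index_map_dvd <|
    QuotientGroup.mk'_surjective (MulAut.conj : G →* MulAut G).range⟩
end

section
/- Let δ ≥ 0, let S be a δ-hyperbolic geodesic metric space, let the group G act on S by isometries, let Q be a subgroup of G, let s, s' ∈ S and let σ ≥ 0. If the orbit Q • s = {q • s : q ∈ Q} is σ-quasi-convex, then the orbit Q • s' is σ'-quasi-convex, where σ' := 2*δ + 2 * dist s s' + σ. -/
theorem IsGeodesic.dist_left_le {S : Type*} [MetricSpace S] {x y : S}
    {γ : Set.Icc (0 : ℝ) (dist x y) → S} (hγ : IsGeodesic γ) (t : Set.Icc (0 : ℝ) (dist x y)) :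
    dist (γ t) x ≤ dist x y := by
  calc dist (γ t) x = dist (γ t) (γ ⟨0, le_rfl, dist_nonneg⟩) := by rw [hγ.2.1]
    _ = |(t : ℝ) - 0| := by rw [hγ.1.dist_eq, Subtype.dist_eq, Real.dist_eq]
    _ ≤ dist x y := by rw [sub_zero, abs_of_nonneg t.2.1]; exact t.2.2

theorem IsGeodesic.dist_right_le {S : Type*} [MetricSpace S] {x y : S}
    {γ : Set.Icc (0 : ℝ) (dist x y) → S} (hγ : IsGeodesic γ) (t : Set.Icc (0 : ℝ) (dist x y)) :
    dist (γ t) y ≤ dist x y := by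
  calc dist (γ t) y = dist (γ t) (γ ⟨dist x y, dist_nonneg, le_rfl⟩) := by rw [hγ.2.2]
    _ = |(t : ℝ) - dist x y| := by rw [hγ.1.dist_eq, Subtype.dist_eq, Real.dist_eq]
    _ ≤ dist x y := by
      rw [abs_sub_comm, abs_of_nonneg (sub_nonneg.2 t.2.2)]
      exact sub_le_self _ t.2.1

theorem cthickening_subset_cthickening_add {S : Type*} [PseudoMetricSpace S] {ε r : ℝ}
    (hε : 0 ≤ ε) (hr : 0 ≤ r) {E F : Set S} (h : E ⊆ Metric.cthickening r F) :
    Metric.cthickening ε E ⊆ Metric.cthickening (ε + r) F :=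
  (Metric.cthickening_subset_of_subset ε h).trans (Metric.cthickening_cthickening_subset hε hr F)

/-- Remark 2.1 ("rem:qc_orbits"): if one orbit `Q • s` of a subgroup `Q` is
`σ`-quasi-convex then any other orbit `Q • s'` is `σ'`-quasi-convex with
`σ' = 2δ + 2 dist s s' + σ`. -/
theorem orbit_quasiconvex_of_orbit_quasiconvex
    {G S : Type*} [Group G] [MetricSpace S] [MulAction G S]
    (hiso : ∀ g : G, Isometry (fun p : S => g • p))
    (δ : ℝ) (hδ : 0 ≤ δ) (hgeo : IsGeodesicSpace S) (hhyp : IsDeltaHyperbolic S δ)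
    (Q : Subgroup G) (s s' : S) (σ : ℝ) (hσ : 0 ≤ σ)
    (hqc : IsQuasiConvex σ ((fun q : G => q • s) '' (Q : Set G))) :
    IsQuasiConvex (2 * δ + 2 * dist s s' + σ)
      ((fun q : G => q • s') '' (Q : Set G)) := by
  have hD : 0 ≤ dist s s' := dist_nonneg
  have hdist : ∀ g : G, dist (g • s) (g • s') = dist s s' := fun g => (hiso g).dist_eq s s'
  rintro _ _ ⟨g, hg, rfl⟩ ⟨h, hh, rfl⟩ γ hγ
  set T := (fun q : G => q • s') '' (Q : Set G) with hT
  have hgT : g • s' ∈ T := ⟨g, hg, rfl⟩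
  have hhT : h • s' ∈ T := ⟨h, hh, rfl⟩
  have horbit : (fun q : G => q • s) '' (Q : Set G) ⊆ Metric.cthickening (dist s s') T := by
    rintro _ ⟨q, hq, rfl⟩
    exact Metric.mem_cthickening_of_dist_le _ (q • s') _ _ ⟨q, hq, rfl⟩ (hdist q).le
  obtain ⟨α, hα⟩ := hgeo (g • s') (g • s)
  obtain ⟨β, hβ⟩ := hgeo (g • s) (h • s)
  obtain ⟨η, hη⟩ := hgeo (g • s') (h • s)
  obtain ⟨ζ, hζ⟩ := hgeo (h • s) (h • s')
  have hαT : Set.range α ⊆ Metric.cthickening (dist s s') T := by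
    rintro _ ⟨t, rfl⟩
    refine Metric.mem_cthickening_of_dist_le _ _ _ _ hgT ((hα.dist_left_le t).trans ?_)
    rw [dist_comm, hdist]
  have hζT : Set.range ζ ⊆ Metric.cthickening (dist s s') T := by
    rintro _ ⟨t, rfl⟩
    exact Metric.mem_cthickening_of_dist_le _ _ _ _ hhT
      ((hζ.dist_right_le t).trans (hdist h).le)
  have hβT : Set.range β ⊆ Metric.cthickening (σ + dist s s') T :=
    (hqc _ _ ⟨g, hg, rfl⟩ ⟨h, hh, rfl⟩ β hβ).trans
      (cthickening_subset_cthickening_add hσ hD horbit)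
  have hηT : Set.range η ⊆ Metric.cthickening (δ + (σ + dist s s')) T :=
    (hhyp _ _ _ α β η hα hβ hη).2.2.trans <|
      cthickening_subset_cthickening_add hδ (by positivity) <|
        Set.union_subset (hαT.trans (Metric.cthickening_mono (by linarith) T)) hβT
  have hγT : Set.range γ ⊆ Metric.cthickening (δ + (δ + (σ + dist s s'))) T :=
    (hhyp _ _ _ η ζ γ hη hζ hγ).2.2.trans <|
      cthickening_subset_cthickening_add hδ (by positivity) <|
        Set.union_subset hηT (hζT.trans (Metric.cthickening_mono (by linarith) T))
  exact hγT.trans (Metric.cthickening_mono (by linarith) T)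
end
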